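/- With the basic-construction setup below, suppose there exists an A-A-bimodular completely positive map Ψ : ⟨M, B̃⟩ → A such that Ψ restricted to M is normal and Ψ restricted to 1_A M e_B M 1_A is nonzero, where e_B := e_{B̃} J1_BJ. Then there exists a normal A-A-bimodular completely positive map Φ : ⟨M, B̃⟩ → A such that Φ(1_A J1_B J) ≠ 0. -/

import Mathlib

/- Framework: von Neumann algebras are modeled concretely as `VonNeumannAlgebra H` for a
complex Hilbert space `H` (in the relevant statements, `H` plays the role of the standard
form Hilbert space `L²(M)`).  Conditional expectations, normality (complete additivity,
phrased via preservation of suprema of upward-directed sets in the Loewner order),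
faithfulness, σ-finiteness, standard forms, Jones basic constructions `⟨M, Q⟩ = (JQJ)'`,
amalgamated free products, Popa's intertwining relation `A ≼_M B` and relative amenability
are all defined below. -/

open scoped InnerProductSpace ComplexOrder

noncomputable section

namespace AFP

variable {H : Type*} [NormedAddCommGroup H] [InnerProductSpace ℂ H] [CompleteSpace H]

abbrev BH (H : Type*) [NormedAddCommGroup H] [InnerProductSpace ℂ H] [CompleteSpace H] :=
  H →L[ℂ] H

/-- A (self-adjoint) projection in `B(H)`. -/
def IsProjection (p : BH H) : Prop := IsSelfAdjoint p ∧ IsIdempotentElem p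

/-- A map defined (at least) on `N ⊆ B(H)` is *normal* on `N` if it preserves suprema of
upward-directed subsets of `N` (with respect to the Loewner order on `B(H)`). -/
def IsNormalOn (N : Set (BH H)) (Φ : BH H → BH H) : Prop :=
  ∀ S : Set (BH H), S ⊆ N → S.Nonempty → DirectedOn (· ≤ ·) S →
    ∀ x ∈ N, IsLUB S x → IsLUB (Φ '' S) (Φ x)

/-- A complex-valued functional is normal on `N` if it preserves suprema of upward-directed
subsets of `N` (using the standard partial order on `ℂ`). -/
def IsNormalFunctionalOn (N : Set (BH H)) (φ : BH H → ℂ) : Prop :=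
  ∀ S : Set (BH H), S ⊆ N → S.Nonempty → DirectedOn (· ≤ ·) S →
    ∀ x ∈ N, IsLUB S x → IsLUB (φ '' S) (φ x)

/-- A map is faithful on `N` if it kills no nonzero positive element of `N`. -/
def FaithfulOn (N : Set (BH H)) (Φ : BH H → BH H) : Prop :=
  ∀ x ∈ N, 0 ≤ x → Φ x = 0 → x = 0

/-- A conditional expectation from `N` onto `P ⊆ N` (as subsets of `B(H)`):
a unital positive `P`-bimodular projection of `N` onto `P`. -/
structure IsCondExp (N P : Set (BH H)) (Φ : BH H → BH H) : Prop where
  subset : P ⊆ N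
  map_add : ∀ x ∈ N, ∀ y ∈ N, Φ (x + y) = Φ x + Φ y
  map_smul : ∀ (c : ℂ), ∀ x ∈ N, Φ (c • x) = c • Φ x
  maps_to : ∀ x ∈ N, Φ x ∈ P
  fixes : ∀ x ∈ P, Φ x = x
  pos : ∀ x ∈ N, 0 ≤ x → 0 ≤ Φ x
  bimod : ∀ a ∈ P, ∀ b ∈ P, ∀ x ∈ N, Φ (a * x * b) = a * Φ x * b

/-- The inclusion `P ⊆ N` is *with expectation*: there is a faithful normal conditional
expectation of `N` onto `P`. -/
def WithExpectation (N P : Set (BH H)) : Prop :=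
  ∃ Φ : BH H → BH H, IsCondExp N P Φ ∧ FaithfulOn N Φ ∧ IsNormalOn N Φ

/-- σ-finiteness (countable decomposability) of a von Neumann algebra viewed as a subset
of `B(H)`: any family of pairwise orthogonal nonzero projections in it is countable. -/
def SigmaFinite (N : Set (BH H)) : Prop :=
  ∀ F : Set (BH H), F ⊆ N → (∀ p ∈ F, IsProjection p ∧ p ≠ 0) →
    (∀ p ∈ F, ∀ q ∈ F, p ≠ q → p * q = 0) → F.Countable

/-- Conjugation `T ↦ J T J` of a bounded operator by a conjugate-linear isometric involution. -/
def conjJ (J : H ≃ₗᵢ⋆[ℂ] H) (T : BH H) : BH H where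
  toFun := fun ξ => J (T (J.symm ξ))
  map_add' := by intro ξ η; simp
  map_smul' := by intro c ξ; simp [map_smulₛₗ]
  cont := J.continuous.comp (T.continuous.comp J.symm.continuous)

/-- Standard form data for a von Neumann algebra `M ⊆ B(H)`: the modular conjugation `J`
and the self-dual positive cone `L²(M)₊`, with their basic properties. -/
structure StandardForm (M : VonNeumannAlgebra H) where
  J : H ≃ₗᵢ⋆[ℂ] H
  cone : Set H
  J_involutive : ∀ ξ, J (J ξ) = ξ
  J_fixes_cone : ∀ ξ ∈ cone, J ξ = ξ
  commutant_eq : Set.centralizer (M : Set (BH H)) = conjJ J '' (M : Set (BH H))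
  selfdual : cone = {ξ : H | ∀ η ∈ cone, 0 ≤ ⟪ξ, η⟫_ℂ}
  cone_invariant : ∀ x ∈ (M : Set (BH H)), ∀ ξ ∈ cone, x (conjJ J x ξ) ∈ cone

/-- The Jones basic construction `⟨M, Q⟩ = (JQJ)'` associated with a subalgebra `Q ⊆ M`,
where `J` is the modular conjugation of `M` in its standard form `H = L²(M)`. -/
def basicConstruction (J : H ≃ₗᵢ⋆[ℂ] H) (Q : Set (BH H)) : Set (BH H) :=
  Set.centralizer (conjJ J '' Q)

/-- The corner `e N e` of a subset `N ⊆ B(H)` by a projection `e`. -/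
def Corner (e : BH H) (N : Set (BH H)) : Set (BH H) := {x | x ∈ N ∧ e * x * e = x}

/-- Popa's intertwining relation `A ≼_N C`: `A` embeds with expectation into `C` inside `N`.
There are projections `e ∈ A`, `f ∈ C`, a nonzero partial isometry `v ∈ eNf` and a unital
normal *-homomorphism `θ : eAe → fCf` such that `θ(eAe) ⊆ fCf` is with expectation and
`a v = v θ(a)` for all `a ∈ eAe`. -/
def EmbedsWE (N A C : Set (BH H)) : Prop :=
  ∃ (e f v : BH H) (θ : BH H → BH H),
    e ∈ A ∧ IsProjection e ∧
    f ∈ C ∧ IsProjection f ∧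
    v ∈ N ∧ v ≠ 0 ∧ v * star v * v = v ∧ e * v = v ∧ v * f = v ∧
    (∀ x ∈ Corner e A, θ x ∈ Corner f C) ∧
    (∀ x ∈ Corner e A, ∀ y ∈ Corner e A, θ (x + y) = θ x + θ y) ∧
    (∀ (c : ℂ), ∀ x ∈ Corner e A, θ (c • x) = c • θ x) ∧
    (∀ x ∈ Corner e A, ∀ y ∈ Corner e A, θ (x * y) = θ x * θ y) ∧
    (∀ x ∈ Corner e A, θ (star x) = star (θ x)) ∧
    θ e = f ∧
    IsNormalOn (Corner e A) θ ∧
    WithExpectation (Corner f C) (θ '' Corner e A) ∧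
    (∀ a ∈ Corner e A, a * v = v * θ a)

/-- Amalgamated free product structure `M = M₁ *_B M₂`: `M` is generated by `M₁` and `M₂`,
which both contain `B`, and `E : M → B` is a faithful normal conditional expectation with
respect to which `M₁` and `M₂` are freely independent with amalgamation over `B`
(`E` kills every reduced word with letters alternating between `ker E ∩ M₁` and
`ker E ∩ M₂`; `E` restricts to the given expectations `Eᵢ : Mᵢ → B`). -/
structure IsAFP (M M₁ M₂ B : VonNeumannAlgebra H) (E : BH H → BH H) : Prop where
  le₁ : (B : Set (BH H)) ⊆ (M₁ : Set (BH H))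
  le₂ : (B : Set (BH H)) ⊆ (M₂ : Set (BH H))
  le₁M : (M₁ : Set (BH H)) ⊆ (M : Set (BH H))
  le₂M : (M₂ : Set (BH H)) ⊆ (M : Set (BH H))
  generated : Set.centralizer (Set.centralizer ((M₁ : Set (BH H)) ∪ (M₂ : Set (BH H)))) = M
  condExp : IsCondExp (M : Set (BH H)) (B : Set (BH H)) E
  faithful : FaithfulOn (M : Set (BH H)) E
  normal : IsNormalOn (M : Set (BH H)) E
  free : ∀ (n : ℕ) (x : Fin n → BH H) (ι : Fin n → Bool), 0 < n →
    (∀ k, x k ∈ (if ι k then (M₁ : Set (BH H)) else (M₂ : Set (BH H))) ∧ E (x k) = 0) →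
    (∀ (k : ℕ) (h : k + 1 < n), ι ⟨k, Nat.lt_of_succ_lt h⟩ ≠ ι ⟨k + 1, h⟩) →
    E (List.ofFn x).prod = 0

/-- `P` is amenable relative to `Q` inside `M` (all sitting in `B(L²(M))`, `J` being the
modular conjugation of `M`): there is a conditional expectation `Φ : ⟨M, Q⟩ → P` whose
restriction to `M` is faithful and normal. -/
def AmenableRel (J : H ≃ₗᵢ⋆[ℂ] H) (Mset P Q : Set (BH H)) : Prop :=
  ∃ Φ : BH H → BH H, IsCondExp (basicConstruction J Q) P Φ ∧
    FaithfulOn Mset Φ ∧ IsNormalOn Mset Φ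

/-- Amenability (injectivity) of a von Neumann algebra `P ⊆ B(H)`: there is a conditional
expectation from all of `B(H)` onto `P`. -/
def IsAmenableVN (P : Set (BH H)) : Prop :=
  ∃ Φ : BH H → BH H, IsCondExp (Set.univ) P Φ

/-- A (possibly non-unital) von Neumann subalgebra `A ⊆ B(H)` with unit the projection
`p = 1_A`: a *-subalgebra with unit `p` which is weakly closed (`p A'' p ⊆ A`). -/
structure IsVNSubalgebra (A : Set (BH H)) (p : BH H) : Prop where
  unit_mem : p ∈ A
  unit_proj : IsProjection p
  unit_left : ∀ x ∈ A, p * x = x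
  unit_right : ∀ x ∈ A, x * p = x
  add_mem : ∀ x ∈ A, ∀ y ∈ A, x + y ∈ A
  mul_mem : ∀ x ∈ A, ∀ y ∈ A, x * y ∈ A
  smul_mem : ∀ (c : ℂ), ∀ x ∈ A, c • x ∈ A
  star_mem : ∀ x ∈ A, star x ∈ A
  weakly_closed : ∀ x ∈ Set.centralizer (Set.centralizer A), p * x * p ∈ A

/-- Complete positivity of a map defined on `D ⊆ B(H)`: all matrix amplifications are
positive. -/
def IsCPOn (D : Set (BH H)) (Φ : BH H → BH H) : Prop :=
  ∀ (n : ℕ) (a : Fin n → BH H), (∀ i, a i ∈ D) → ∀ v : Fin n → H,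
    0 ≤ ∑ i : Fin n, ∑ j : Fin n, ⟪v i, (Φ (star (a i) * a j)) (v j)⟫_ℂ

/-- An `A`-`A`-bimodular completely positive map from `D ⊆ B(H)` into `A`. -/
structure IsBimodCP (D A : Set (BH H)) (Φ : BH H → BH H) : Prop where
  maps_to : ∀ T ∈ D, Φ T ∈ A
  map_add : ∀ T ∈ D, ∀ S ∈ D, Φ (T + S) = Φ T + Φ S
  map_smul : ∀ (c : ℂ), ∀ T ∈ D, Φ (c • T) = c • Φ T
  cp : IsCPOn D Φ
  bimod : ∀ a ∈ A, ∀ b ∈ A, ∀ T ∈ D, Φ (a * T * b) = a * Φ T * b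

/-- `B̃ := B ⊕ ℂ 1_B^⊥ ⊆ M`, where `1_B = pB` is the unit of `B`. -/
def Btilde (Bset : Set (BH H)) (pB : BH H) : Set (BH H) :=
  {x : BH H | ∃ b ∈ Bset, ∃ c : ℂ, x = b + c • ((1 : BH H) - pB)}


section

section gen
variable {K : Type*} [NormedAddCommGroup K] [InnerProductSpace ℂ K] [CompleteSpace K]

theorem nonneg_iff_inner (T : K →L[ℂ] K) : 0 ≤ T ↔ ∀ v, 0 ≤ ⟪v, T v⟫_ℂ := by
  rw [ContinuousLinearMap.nonneg_iff_isPositive]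
  constructor
  · intro h v; exact h.inner_nonneg_right v
  · intro h
    rw [ContinuousLinearMap.isPositive_iff_complex]
    intro v
    have h1 := h v
    rw [← inner_conj_symm] at h1
    have h2 : 0 ≤ ⟪T v, v⟫_ℂ := by simpa using (star_nonneg_iff.mpr h1)
    rw [Complex.nonneg_iff] at h2
    refine ⟨?_, h2.1⟩
    apply Complex.ext
    · simp
    · simpa using h2.2

theorem commute_sqrt {T S : K →L[ℂ] K} (h : T * S = S * T) :
    CFC.sqrt T * S = S * CFC.sqrt T := by
  rw [CFC.sqrt_eq_cfc]
  exact Commute.cfc_nnreal (a := T) (b := S) h _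

theorem sqrt_sa (T : K →L[ℂ] K) : star (CFC.sqrt T) = CFC.sqrt T :=
  (IsSelfAdjoint.of_nonneg (CFC.sqrt_nonneg T)).star_eq

theorem norm_le_of_le {T S : K →L[ℂ] K} (h0 : 0 ≤ T) (h : T ≤ S) : ‖T‖ ≤ ‖S‖ :=
  CStarAlgebra.norm_le_norm_of_nonneg_of_le h0 h

theorem ball_lim {ι : Type*} (U : Ultrafilter ι) (f : ι → ℂ) (C : ℝ)
    (h : ∀ᶠ i in (U : Filter ι), ‖f i‖ ≤ C) : ∃ l : ℂ, Filter.Tendsto f U (nhds l) := by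
  have hc : IsCompact (Metric.closedBall (0:ℂ) C) := isCompact_closedBall 0 C
  obtain ⟨l, -, hl⟩ := hc.ultrafilter_le_nhds (U.map f) (by
    simp only [Filter.le_principal_iff, Ultrafilter.mem_coe, Ultrafilter.mem_map]
    filter_upwards [h] with i hi
    simpa using hi)
  exact ⟨l, hl⟩

/-- monotone convergence, weak form -/
theorem vigier {ι : Type*} [Preorder ι] [IsDirectedOrder ι] [Nonempty ι]
    (F : ι → K →L[ℂ] K) (hF : Monotone F) (x : K →L[ℂ] K) (hx : IsLUB (Set.range F) x) (v : K) :
    Filter.Tendsto (fun i => (⟪v, (x - F i) v⟫_ℂ).re) Filter.atTop (nhds 0) := by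
  set U : Ultrafilter ι := Ultrafilter.of Filter.atTop with hU
  have hUle : (U : Filter ι) ≤ Filter.atTop := Ultrafilter.of_le _
  have hle : ∀ i, F i ≤ x := fun i => hx.1 ⟨i, rfl⟩
  have hpos : ∀ i, 0 ≤ x - F i := fun i => sub_nonneg.mpr (hle i)
  obtain ⟨i0⟩ := ‹Nonempty ι›
  set C := ‖x - F i0‖ with hC
  have hbd : ∀ᶠ i in (U : Filter ι), ‖x - F i‖ ≤ C := by
    have := hUle (Filter.eventually_ge_atTop i0)
    filter_upwards [this] with i hi
    exact norm_le_of_le (hpos i) (sub_le_sub_left (hF hi) x)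
  have hbd2 : ∀ u w, ∀ᶠ i in (U : Filter ι), ‖⟪u, (x - F i) w⟫_ℂ‖ ≤ C * ‖u‖ * ‖w‖ := by
    intro u w
    filter_upwards [hbd] with i hi
    calc ‖⟪u, (x - F i) w⟫_ℂ‖ ≤ ‖u‖ * ‖(x - F i) w‖ := norm_inner_le_norm _ _
      _ ≤ ‖u‖ * (C * ‖w‖) := by
        gcongr
        exact (x - F i).le_of_opNorm_le hi w
      _ = _ := by ring
  have hl : ∀ u w, ∃ l, Filter.Tendsto (fun i => ⟪u, (x - F i) w⟫_ℂ) U (nhds l) :=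
    fun u w => ball_lim U _ _ (hbd2 u w)
  choose L hL using hl
  let B0 : K →ₗ⋆[ℂ] K →ₗ[ℂ] ℂ := LinearMap.mk₂'ₛₗ (starRingEnd ℂ) (RingHom.id ℂ) L
    (fun a b c => tendsto_nhds_unique (hL _ _) (by
      simpa only [inner_add_left] using (hL a c).add (hL b c)))
    (fun a b c => tendsto_nhds_unique (hL _ _) (by
      simpa only [inner_smul_left, smul_eq_mul] using (hL b c).const_mul (starRingEnd ℂ a)))
    (fun a b c => tendsto_nhds_unique (hL _ _) (by
      simpa only [map_add, inner_add_right] using (hL a b).add (hL a c)))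
    (fun a b c => tendsto_nhds_unique (hL _ _) (by
      simpa only [map_smul, inner_smul_right, smul_eq_mul, RingHom.id_apply] using (hL b c).const_mul a))
  let B : K →L⋆[ℂ] K →L[ℂ] ℂ := B0.mkContinuous₂ C (fun u w =>
    le_of_tendsto (hL u w).norm (hbd2 u w))
  let D : K →L[ℂ] K := star (InnerProductSpace.continuousLinearMapOfBilin B)
  have hD : ∀ u w, ⟪u, D w⟫_ℂ = L u w := by
    intro u w
    simp only [D, ContinuousLinearMap.star_eq_adjoint, ContinuousLinearMap.adjoint_inner_right,
      InnerProductSpace.continuousLinearMapOfBilin_apply]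
    rfl
  have hDle : ∀ i, F i ≤ x - D := by
    intro i
    rw [← sub_nonneg, nonneg_iff_inner]
    intro u
    have h1 : Filter.Tendsto (fun j => ⟪u, (x - F i) u⟫_ℂ - ⟪u, (x - F j) u⟫_ℂ) U
      (nhds (⟪u, (x - F i) u⟫_ℂ - L u u)) := (hL u u).const_sub _
    have h2 : ⟪u, (x - D - F i) u⟫_ℂ = ⟪u, (x - F i) u⟫_ℂ - L u u := by
      rw [← hD]; simp [inner_sub_right]; ring
    rw [h2]
    refine ge_of_tendsto h1 ?_
    filter_upwards [hUle (Filter.eventually_ge_atTop i)] with j hj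
    have := (nonneg_iff_inner _).1 (sub_nonneg.mpr (hF hj)) u
    convert this using 1
    simp [inner_sub_right]
  have hx2 : x ≤ x - D := hx.2 (by rintro _ ⟨i, rfl⟩; exact hDle i)
  have hL0 : (L v v).re ≤ 0 := by
    have := (nonneg_iff_inner _).1 (sub_nonneg.mpr hx2) v
    have h3 : ⟪v, (x - D - x) v⟫_ℂ = - L v v := by rw [← hD]; simp [inner_sub_right]
    rw [h3, Complex.nonneg_iff] at this
    have := this.1
    simp at this; exact this
  have hanti : Antitone (fun i => (⟪v, (x - F i) v⟫_ℂ).re) := by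
    intro i j hij
    have := (nonneg_iff_inner _).1 (sub_nonneg.mpr (hF hij)) v
    have := (Complex.nonneg_iff.1 this).1
    simp only [ContinuousLinearMap.sub_apply, inner_sub_right, Complex.sub_re] at this ⊢
    linarith
  have hnn : ∀ i, 0 ≤ (⟪v, (x - F i) v⟫_ℂ).re := fun i =>
    (Complex.nonneg_iff.1 ((nonneg_iff_inner _).1 (hpos i) v)).1
  have ht := tendsto_atTop_ciInf hanti ⟨0, by rintro _ ⟨i, rfl⟩; exact hnn i⟩
  have ht2 := tendsto_nhds_unique (ht.mono_left hUle) ((Complex.continuous_re.tendsto _).comp (hL v v))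
  have : ⨅ i, (⟪v, (x - F i) v⟫_ℂ).re = 0 := by
    apply le_antisymm
    · rw [ht2]; exact hL0
    · have : Nonempty ι := ⟨i0⟩
      exact le_ciInf hnn
  rwa [this] at ht

theorem quad_add_le (T : K →L[ℂ] K) (hT : 0 ≤ T) (u w : K) :
    (⟪u + w, T (u + w)⟫_ℂ).re ≤ 2 * (⟪u, T u⟫_ℂ).re + 2 * (⟪w, T w⟫_ℂ).re := by
  have := (Complex.nonneg_iff.1 ((nonneg_iff_inner _).1 hT (u - w))).1
  simp only [map_sub, map_add, inner_sub_left, inner_sub_right, inner_add_left, inner_add_right,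
    Complex.sub_re, Complex.add_re] at this ⊢
  linarith

/-- vectors on which a decreasing positive net tends to zero form a closed subspace -/
theorem null_closed {ι : Type*} [Preorder ι] [IsDirectedOrder ι] [Nonempty ι]
    (F : ι → K →L[ℂ] K) (hF : Antitone F) (h0 : ∀ i, 0 ≤ F i) (s : Set K)
    (hs : ∀ v ∈ s, Filter.Tendsto (fun i => (⟪v, F i v⟫_ℂ).re) Filter.atTop (nhds 0)) :
    ∀ v ∈ (Submodule.span ℂ s).topologicalClosure,
      Filter.Tendsto (fun i => (⟪v, F i v⟫_ℂ).re) Filter.atTop (nhds 0) := by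
  have hnn : ∀ i v, 0 ≤ (⟪v, F i v⟫_ℂ).re := fun i v =>
    (Complex.nonneg_iff.1 ((nonneg_iff_inner _).1 (h0 i) v)).1
  have h1 : ∀ v ∈ Submodule.span ℂ s,
      Filter.Tendsto (fun i => (⟪v, F i v⟫_ℂ).re) Filter.atTop (nhds 0) := by
    intro v hv
    induction hv using Submodule.span_induction with
    | mem v hv => exact hs v hv
    | zero => simp
    | add u w _ _ hu hw =>
      refine squeeze_zero (fun i => hnn i _) (fun i => quad_add_le (F i) (h0 i) u w) ?_
      simpa using (hu.const_mul 2).add (hw.const_mul 2)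
    | smul c u _ hu =>
      have : ∀ i, (⟪c • u, F i (c • u)⟫_ℂ).re = ‖c‖ ^ 2 * (⟪u, F i u⟫_ℂ).re := by
        intro i
        rw [map_smul, inner_smul_left, inner_smul_right, ← mul_assoc, Complex.conj_mul']
        rw [← Complex.ofReal_pow, Complex.re_ofReal_mul]
      simp only [this]
      simpa using hu.const_mul (‖c‖ ^ 2)
  intro v hv
  obtain ⟨i0⟩ := ‹Nonempty ι›
  rw [Metric.tendsto_nhds]
  intro ε hε
  have hv' : v ∈ closure (Submodule.span ℂ s : Set K) := hv
  obtain ⟨u, hu, hvu⟩ := Metric.mem_closure_iff.1 hv' (Real.sqrt (ε / (4 * (‖F i0‖ + 1))))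
    (by positivity)
  have hvu2 : ‖v - u‖ ^ 2 * (‖F i0‖ + 1) < ε / 4 := by
    rw [dist_eq_norm] at hvu
    have : ‖v - u‖ ^ 2 < ε / (4 * (‖F i0‖ + 1)) := by
      have := pow_lt_pow_left₀ hvu (norm_nonneg _) (n := 2) (by norm_num)
      rwa [Real.sq_sqrt (by positivity)] at this
    rw [lt_div_iff₀ (by positivity)] at this
    linarith
  filter_upwards [(Metric.tendsto_nhds.1 (h1 u hu)) (ε / 4) (by positivity),
    Filter.eventually_ge_atTop i0] with i h3 hi
  rw [dist_zero_right, Real.norm_of_nonneg (hnn _ _)] at h3 ⊢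
  have h4 := quad_add_le (F i) (h0 i) u (v - u)
  rw [add_sub_cancel] at h4
  have h5 : (⟪v - u, F i (v - u)⟫_ℂ).re ≤ ‖v - u‖ ^ 2 * (‖F i0‖ + 1) := by
    calc (⟪v - u, F i (v - u)⟫_ℂ).re ≤ ‖⟪v - u, F i (v - u)⟫_ℂ‖ := Complex.re_le_norm _
      _ ≤ ‖v - u‖ * ‖F i (v - u)‖ := norm_inner_le_norm _ _
      _ ≤ ‖v - u‖ * ((‖F i0‖ + 1) * ‖v - u‖) := by
        gcongr
        refine (F i).le_of_opNorm_le ?_ _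
        have := norm_le_of_le (h0 i) (hF hi)
        linarith
      _ = _ := by ring
  linarith

/-- a closed subspace invariant under `T` and its adjoint reduces `T` -/
theorem comm_proj (T : K →L[ℂ] K) (s : Set K) (Q : Submodule ℂ K)
    (hQ : Q = (Submodule.span ℂ s).topologicalClosure) [Q.HasOrthogonalProjection]
    (h1 : ∀ v ∈ s, T v ∈ Q) (h2 : ∀ v ∈ s, star T v ∈ Q) (v : K) :
    Q.starProjection (T v) = T (Q.starProjection v) := by
  have key : ∀ S : K →L[ℂ] K, (∀ v ∈ s, S v ∈ Q) → ∀ v ∈ Q, S v ∈ Q := by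
    intro S hS v hv
    have hcl : IsClosed (Q : Set K) := by rw [hQ]; exact Submodule.isClosed_topologicalClosure _
    have hle : Q ≤ Q.comap S.toLinearMap := by
      conv_lhs => rw [hQ]
      apply Submodule.topologicalClosure_minimal
      · exact Submodule.span_le.2 hS
      · exact hcl.preimage S.continuous
    exact hle hv
  refine Submodule.eq_starProjection_of_mem_of_inner_eq_zero (K := Q) ?_ ?_
  · exact key T h1 _ (Submodule.starProjection_apply_mem _ _)
  · intro w hw
    rw [← map_sub, ← ContinuousLinearMap.adjoint_inner_right]
    have := key (star T) h2 w hw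
    exact Submodule.starProjection_inner_eq_zero _ _ this

end gen

end

section

theorem inner_self_c {K : Type*} [NormedAddCommGroup K] [InnerProductSpace ℂ K] (v : K) :
    ⟪v, v⟫_ℂ = ((‖v‖ ^ 2 : ℝ) : ℂ) := by
  rw [inner_self_eq_norm_sq_to_K (𝕜 := ℂ)]; simp

theorem star_inner {K : Type*} [NormedAddCommGroup K] [InnerProductSpace ℂ K] [CompleteSpace K]
    (T : K →L[ℂ] K) (a b : K) : ⟪star T a, b⟫_ℂ = ⟪a, T b⟫_ℂ := by
  rw [ContinuousLinearMap.star_eq_adjoint, ContinuousLinearMap.adjoint_inner_left]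

theorem inner_star {K : Type*} [NormedAddCommGroup K] [InnerProductSpace ℂ K] [CompleteSpace K]
    (T : K →L[ℂ] K) (a b : K) : ⟪a, star T b⟫_ℂ = ⟪T a, b⟫_ℂ := by
  rw [ContinuousLinearMap.star_eq_adjoint, ContinuousLinearMap.adjoint_inner_right]

theorem sa_inner {K : Type*} [NormedAddCommGroup K] [InnerProductSpace ℂ K] [CompleteSpace K]
    {T : K →L[ℂ] K} (h : star T = T) (a b : K) : ⟪T a, b⟫_ℂ = ⟪a, T b⟫_ℂ := by
  conv_lhs => rw [← h]
  exact star_inner T a b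

theorem sa_decomp (x : BH H) : ∃ a b : BH H, star a = a ∧ star b = b ∧ x = a + Complex.I • b ∧
    a = (1/2 : ℂ) • (x + star x) ∧ b = (-Complex.I/2) • (x - star x) := by
  refine ⟨_, _, ?_, ?_, ?_, rfl, rfl⟩
  · simp [add_comm]
  · simp only [star_smul, star_sub, star_star]
    rw [← neg_sub x (star x), smul_neg, ← neg_smul]
    congr 1
    simp [neg_div]
  · rw [smul_smul, show Complex.I * (-Complex.I/2) = 1/2 by rw [mul_div_assoc', mul_neg, Complex.I_mul_I]; norm_num]
    rw [← smul_add]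
    rw [show x + star x + (x - star x) = (2:ℂ) • x by rw [two_smul]; abel]
    rw [smul_smul]; norm_num

def dbl (x : BH H) : WithLp 2 (H × H) →L[ℂ] WithLp 2 (H × H) :=
  (WithLp.prodContinuousLinearEquiv 2 ℂ H H).symm.toContinuousLinearMap ∘L
    (x.prodMap x) ∘L (WithLp.prodContinuousLinearEquiv 2 ℂ H H).toContinuousLinearMap

theorem dbl_apply (x : BH H) (a : WithLp 2 (H × H)) :
    dbl x a = WithLp.toLp 2 (x a.fst, x a.snd) := rfl

theorem dbl_star (x : BH H) : star (dbl x) = dbl (star x) := by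
  symm
  rw [ContinuousLinearMap.star_eq_adjoint (A := dbl x), ContinuousLinearMap.eq_adjoint_iff]
  intro a b
  simp only [dbl_apply, WithLp.prod_inner_apply]
  simp [star_inner]

def inlL : H →L[ℂ] WithLp 2 (H × H) :=
  (WithLp.prodContinuousLinearEquiv 2 ℂ H H).symm.toContinuousLinearMap ∘L
    ContinuousLinearMap.inl ℂ H H
def inrL : H →L[ℂ] WithLp 2 (H × H) :=
  (WithLp.prodContinuousLinearEquiv 2 ℂ H H).symm.toContinuousLinearMap ∘L
    ContinuousLinearMap.inr ℂ H H
def fstLL : WithLp 2 (H × H) →L[ℂ] H :=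
  ContinuousLinearMap.fst ℂ H H ∘L (WithLp.prodContinuousLinearEquiv 2 ℂ H H).toContinuousLinearMap

theorem inlL_apply (a : H) : inlL a = WithLp.toLp 2 (a, 0) := rfl
theorem inrL_apply (a : H) : inrL a = WithLp.toLp 2 (0, a) := rfl
theorem fstLL_apply (a : WithLp 2 (H × H)) : fstLL a = a.fst := rfl

theorem rvd (M : VonNeumannAlgebra H) (ξ η : H)
    (hd : Dense {η : H | ∃ x ∈ (M : Set (BH H)), x ξ = η})
    (h1 : ∀ x ∈ (M : Set (BH H)), star x = x → (⟪x ξ, η⟫_ℂ).re = 0)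
    (h2 : ∀ y ∈ Set.centralizer (M : Set (BH H)), star y = y → (⟪η, y ξ⟫_ℂ).im = 0) : η = 0 := by
  have h1a : ∀ x ∈ (M : Set (BH H)), star x = x → ⟪η, x ξ⟫_ℂ + ⟪ξ, x η⟫_ℂ = 0 := by
    intro x hx hs
    have e : ⟪ξ, x η⟫_ℂ = ⟪x ξ, η⟫_ℂ := by
      conv_lhs => rw [← hs]
      rw [ContinuousLinearMap.star_eq_adjoint, ContinuousLinearMap.adjoint_inner_right]
    rw [e, ← inner_conj_symm η (x ξ), add_comm, Complex.add_conj, h1 x hx hs]; simp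
  have h2a : ∀ x ∈ Set.centralizer (M : Set (BH H)), star x = x → ⟪η, x ξ⟫_ℂ - ⟪ξ, x η⟫_ℂ = 0 := by
    intro x hx hs
    have e : ⟪ξ, x η⟫_ℂ = ⟪x ξ, η⟫_ℂ := by
      conv_lhs => rw [← hs]
      rw [ContinuousLinearMap.star_eq_adjoint, ContinuousLinearMap.adjoint_inner_right]
    rw [e, ← inner_conj_symm (x ξ) η, Complex.sub_conj, h2 x hx hs]; simp
  have h1b : ∀ x ∈ (M : Set (BH H)), ⟪η, x ξ⟫_ℂ + ⟪ξ, x η⟫_ℂ = 0 := by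
    intro x hx
    obtain ⟨a, b, ha, hb, e, ea, eb⟩ := sa_decomp x
    have hxs : star x ∈ M := star_mem hx
    have ham : a ∈ (M : Set (BH H)) := by
      rw [ea]; exact M.toStarSubalgebra.smul_mem (add_mem hx hxs) _
    have hbm : b ∈ (M : Set (BH H)) := by
      rw [eb]; exact M.toStarSubalgebra.smul_mem (sub_mem hx hxs) _
    rw [e]
    simp only [_root_.add_apply, _root_.smul_apply, inner_add_right, inner_smul_right]
    linear_combination h1a a ham ha + Complex.I * h1a b hbm hb
  have h2b : ∀ x ∈ Set.centralizer (M : Set (BH H)), ⟪η, x ξ⟫_ℂ = ⟪ξ, x η⟫_ℂ := by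
    intro x hx
    have hx' : x ∈ M.commutant := by
      rw [← SetLike.mem_coe, VonNeumannAlgebra.coe_commutant]; exact hx
    obtain ⟨a, b, ha, hb, e, ea, eb⟩ := sa_decomp x
    have hxs : star x ∈ M.commutant := star_mem hx'
    have ham : a ∈ Set.centralizer (M : Set (BH H)) := by
      rw [← VonNeumannAlgebra.coe_commutant]
      rw [ea]; exact M.commutant.toStarSubalgebra.smul_mem (add_mem hx' hxs) _
    have hbm : b ∈ Set.centralizer (M : Set (BH H)) := by
      rw [← VonNeumannAlgebra.coe_commutant]
      rw [eb]; exact M.commutant.toStarSubalgebra.smul_mem (sub_mem hx' hxs) _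
    rw [e]
    simp only [_root_.add_apply, _root_.smul_apply, inner_add_right, inner_smul_right]
    linear_combination h2a a ham ha + Complex.I * h2a b hbm hb
  let s : Set (WithLp 2 (H × H)) := {w | ∃ x ∈ (M : Set (BH H)), w = WithLp.toLp 2 (x ξ, x η)}
  let Q : Submodule ℂ (WithLp 2 (H × H)) := (Submodule.span ℂ s).topologicalClosure
  have : CompleteSpace Q := (Submodule.isClosed_topologicalClosure _).completeSpace_coe
  let f := Q.starProjection
  have hsQ : ∀ w ∈ s, w ∈ Q := fun w hw => Submodule.le_topologicalClosure _ (Submodule.subset_span hw)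
  have hinv : ∀ x ∈ (M : Set (BH H)), ∀ w ∈ s, dbl x w ∈ Q := by
    rintro x hx w ⟨y, hy, rfl⟩
    exact hsQ _ ⟨x * y, mul_mem hx hy, rfl⟩
  have hcomm : ∀ x ∈ (M : Set (BH H)), ∀ w, f (dbl x w) = dbl x (f w) := by
    intro x hx w
    refine comm_proj (dbl x) s Q rfl (hinv x hx) ?_ w
    rw [dbl_star]; exact hinv _ (star_mem hx)
  have hf1 : f (WithLp.toLp 2 (ξ, η)) = WithLp.toLp 2 (ξ, η) :=
    Submodule.starProjection_eq_self_iff.2 (hsQ _ ⟨1, one_mem M, by simp⟩)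
  have hf2 : f (WithLp.toLp 2 (η, ξ)) = 0 := by
    rw [Submodule.starProjection_apply_eq_zero_iff]
    rw [Submodule.mem_orthogonal']
    have hle : Q ≤ (LinearMap.ker (innerSL ℂ (WithLp.toLp 2 (η, ξ))).toLinearMap) := by
      apply Submodule.topologicalClosure_minimal
      · rw [Submodule.span_le]
        rintro _ ⟨x, hx, rfl⟩
        simp only [SetLike.mem_coe, LinearMap.mem_ker]
        simpa [WithLp.prod_inner_apply] using h1b x hx
      · exact ContinuousLinearMap.isClosed_ker _
    intro u hu
    simpa using hle hu
  let f11 : BH H := fstLL ∘L f ∘L inlL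
  let f12 : BH H := fstLL ∘L f ∘L inrL
  have m11 : ∀ x ∈ (M : Set (BH H)), ∀ v, f11 (x v) = x (f11 v) := by
    intro x hx v
    have := congrArg fstLL (hcomm x hx (inlL v))
    simpa [dbl_apply, inlL_apply, fstLL_apply, f11] using this
  have m12 : f12 ∈ Set.centralizer (M : Set (BH H)) := by
    rw [Set.mem_centralizer_iff]
    intro x hx
    ext v
    have := congrArg fstLL (hcomm x hx (inrL v))
    simpa [dbl_apply, inrL_apply, fstLL_apply, f12] using this.symm
  have split : ∀ a b : H, (WithLp.toLp 2 (a, b) : WithLp 2 (H × H)) = inlL a + inrL b := by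
    intro a b
    rw [inlL_apply, inrL_apply, ← WithLp.toLp_add]; simp
  have e1 : f11 ξ + f12 η = ξ := by
    have := congrArg fstLL hf1
    rw [split, map_add, map_add] at this
    simpa [f11, f12, inlL_apply, inrL_apply, fstLL_apply] using this
  have e2 : f11 η + f12 ξ = 0 := by
    have := congrArg fstLL hf2
    rw [split, map_add, map_add] at this
    simpa [f11, f12, inlL_apply, inrL_apply, fstLL_apply] using this
  have q11 : ∀ v, ⟪v, f11 v⟫_ℂ = ((‖f (inlL v)‖ ^ 2 : ℝ) : ℂ) := by
    intro v
    have : ⟪v, f11 v⟫_ℂ = ⟪inlL v, f (inlL v)⟫_ℂ := by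
      simp [f11, inlL_apply, fstLL_apply, WithLp.prod_inner_apply]
    rw [this, ← inner_self_c]
    rw [Submodule.inner_starProjection_left_eq_right]
    congr 1
    exact (Submodule.starProjection_eq_self_iff.2 (Submodule.starProjection_apply_mem _ _)).symm
  have n11 : ∀ v, ‖f (inlL v)‖ ≤ ‖v‖ := by
    intro v
    have h := Submodule.norm_starProjection_apply_le Q (inlL v)
    have h2 : ‖inlL v‖ = ‖v‖ := by
      rw [inlL_apply]; simp
    exact h2 ▸ h
  have pos11 : 0 ≤ 1 - f11 := by
    rw [nonneg_iff_inner]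
    intro v
    simp only [_root_.sub_apply, one_apply_eq_self, inner_sub_right, q11]
    rw [inner_self_c]
    have := n11 v
    have h3 : ‖f (inlL v)‖ ^ 2 ≤ ‖v‖ ^ 2 := by gcongr
    rw [sub_nonneg]
    exact_mod_cast h3
  have k1 : ⟪ξ, (1 - f11) ξ⟫_ℂ = 0 := by
    have a1 : (1 - f11) ξ = f12 η := by
      simp only [_root_.sub_apply, one_apply_eq_self]
      rw [sub_eq_iff_eq_add, add_comm]; exact e1.symm
    have a2 : f12 ξ = - f11 η := by rw [eq_neg_iff_add_eq_zero, add_comm]; exact e2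
    have a3 : ⟪ξ, (1 - f11) ξ⟫_ℂ = - ⟪η, f11 η⟫_ℂ := by
      rw [a1, ← h2b f12 m12, a2, inner_neg_right]
    apply le_antisymm
    · rw [a3, q11, neg_nonpos]
      have : (0:ℝ) ≤ ‖f (inlL η)‖ ^ 2 := by positivity
      exact_mod_cast this
    · exact (nonneg_iff_inner _).1 pos11 ξ
  have k2 : (1 - f11) ξ = 0 := by
    set r := CFC.sqrt (1 - f11) with hr
    have hrr : r * r = 1 - f11 := CFC.sqrt_mul_sqrt_self _ pos11
    have : r ξ = 0 := by
      rw [← inner_self_eq_zero (𝕜 := ℂ)]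
      rw [← k1, ← hrr]
      exact sa_inner (sqrt_sa _) _ _
    rw [← hrr, mul_apply_eq_comp, this, map_zero]
  have k3 : ∀ v, f11 v = v := by
    intro v
    have hcl : IsClosed {v | f11 v = v} := isClosed_eq f11.continuous continuous_id
    have := hd.closure_eq ▸ closure_minimal (s := {η : H | ∃ x ∈ (M : Set (BH H)), x ξ = η}) (t := {v | f11 v = v}) (by
      rintro _ ⟨x, hx, rfl⟩
      have k2' : f11 ξ = ξ := by
        have := k2
        simp only [_root_.sub_apply, one_apply_eq_self] at this
        exact (sub_eq_zero.1 this).symm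
      show f11 (x ξ) = x ξ
      rw [m11 x hx, k2']) hcl
    exact this (Set.mem_univ v)
  have k6 : ∀ v, f (inlL v) = inlL v := by
    intro v
    have hn : ‖f (inlL v)‖ = ‖inlL v‖ := by
      have hq := q11 v
      rw [k3, inner_self_c] at hq
      have hq' : ‖v‖ ^ 2 = ‖f (inlL v)‖ ^ 2 := by exact_mod_cast hq
      have : ‖v‖ = ‖f (inlL v)‖ := (sq_eq_sq₀ (norm_nonneg _) (norm_nonneg _)).1 hq'
      rw [← this, inlL_apply]; simp
    rw [Submodule.starProjection_eq_self_iff]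
    exact (Submodule.mem_iff_norm_starProjection Q _).2 hn
  -- orthogonality to (η, ξ)
  have k7 : ⟪inlL η, WithLp.toLp 2 (η, ξ)⟫_ℂ = 0 := by
    rw [← k6 η]
    show ⟪Q.starProjection (inlL η), _⟫_ℂ = 0
    rw [Submodule.inner_starProjection_left_eq_right]
    show ⟪_, f _⟫_ℂ = 0
    rw [hf2, inner_zero_right]
  have : ⟪η, η⟫_ℂ = 0 := by
    simpa [inlL_apply, WithLp.prod_inner_apply] using k7
  exact inner_self_eq_zero.1 this

end

section

theorem le_of_sq_le_sq_n {E F : Type*} [NormedAddCommGroup E] [NormedAddCommGroup F] {a : E} {b : F}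
    (h : ‖a‖ ^ 2 ≤ ‖b‖ ^ 2) : ‖a‖ ≤ ‖b‖ :=
  (sq_le_sq₀ (norm_nonneg _) (norm_nonneg _)).1 h

theorem lemE {E : Type*} [NormedAddCommGroup E] [InnerProductSpace ℝ E] (R q : E →L[ℝ] E)
    (hsym : ∀ v w, ⟪R v, w⟫_ℝ = ⟪v, R w⟫_ℝ) (hpos : ∀ v, 0 ≤ ⟪v, R v⟫_ℝ)
    (hcon : ∀ v, ‖R v‖ ≤ ‖v‖) (hinj : ∀ v, R v = 0 → v = 0)
    (hc : R * R * q = q * (R * R)) : R * q = q * R := by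
  set X := R * q - q * R with hX
  have h1 : R * X = - (X * R) := by
    rw [hX]
    have : R * (R * q) = q * R * R := by rw [← mul_assoc, hc, mul_assoc]
    rw [mul_sub, sub_mul, this]; noncomm_ring
  have hpow : ∀ n : ℕ, (1 + R) ^ n * X = X * (1 - R) ^ n := by
    intro n
    induction n with
    | zero => simp
    | succ n ih =>
      rw [pow_succ, mul_assoc, pow_succ']
      have : (1 + R) * X = X * (1 - R) := by
        rw [add_mul, h1]; noncomm_ring
      rw [this, ← mul_assoc, ih, mul_assoc, pow_mul_comm']
  have hR2 : ∀ v, ‖R v‖ ^ 2 ≤ ⟪v, R v⟫_ℝ := by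
    intro v
    have h := hpos (v - R v)
    simp only [map_sub, inner_sub_left, inner_sub_right] at h
    have a1 : ⟪R v, R v⟫_ℝ = ‖R v‖ ^ 2 := real_inner_self_eq_norm_sq _
    have a2 : ⟪v, R (R v)⟫_ℝ = ⟪R v, R v⟫_ℝ := (hsym _ _).symm
    have a3 : ⟪R v, R (R v)⟫_ℝ ≤ ⟪R v, R v⟫_ℝ := by
      calc ⟪R v, R (R v)⟫_ℝ ≤ ‖R v‖ * ‖R (R v)‖ := real_inner_le_norm _ _
        _ ≤ ‖R v‖ * ‖R v‖ := by gcongr; exact hcon _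
        _ = _ := by rw [a1]; ring
    have := hpos (R v)
    linarith
  have hm : ∀ v, ‖(1 - R) v‖ ≤ ‖v‖ := by
    intro v
    have : ‖v - R v‖ ^ 2 ≤ ‖v‖ ^ 2 := by
      rw [norm_sub_sq_real]
      have := hR2 v
      have := hpos v
      linarith
    exact le_of_sq_le_sq_n this
  have hmn : ∀ (n : ℕ) v, ‖((1 - R) ^ n) v‖ ≤ ‖v‖ := by
    intro n
    induction n with
    | zero => simp
    | succ n ih =>
      intro v
      rw [pow_succ, mul_apply_eq_comp]
      exact (ih _).trans (hm v)
  have hp : ∀ v, ‖v‖ ^ 2 + ‖R v‖ ^ 2 ≤ ‖(1 + R) v‖ ^ 2 := by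
    intro v
    show _ ≤ ‖v + R v‖ ^ 2
    rw [norm_add_sq_real]
    have := hpos v
    linarith
  have hpn : ∀ (n : ℕ) v, ‖v‖ ≤ ‖((1 + R) ^ n) v‖ := by
    intro n
    induction n with
    | zero => simp
    | succ n ih =>
      intro v
      rw [pow_succ, mul_apply_eq_comp]
      refine le_trans ?_ (ih _)
      have := hp v
      refine le_of_sq_le_sq_n ?_
      nlinarith [sq_nonneg ‖R v‖]
  have hcomm : ∀ n : ℕ, R * (1 + R) ^ n = (1 + R) ^ n * R := by
    intro n
    have : Commute R ((1 + R) ^ n) := Commute.pow_right (by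
      show R * (1 + R) = (1 + R) * R
      noncomm_ring) n
    exact this
  have hlow : ∀ (n : ℕ) u, n * ‖R u‖ ^ 2 ≤ ‖((1 + R) ^ n) u‖ ^ 2 := by
    intro n u
    induction n with
    | zero => simp
    | succ n ih =>
      have e0 : ((1 + R) ^ (n + 1)) u = (1 + R) (((1 + R) ^ n) u) := by
        rw [pow_succ' (1 + R)]; rfl
      rw [e0]
      have a := hp (((1 + R) ^ n) u)
      have b : ‖R u‖ ≤ ‖R (((1 + R) ^ n) u)‖ := by
        have := hpn n (R u)
        have e : R (((1 + R) ^ n) u) = ((1 + R) ^ n) (R u) := by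
          have := congrArg (fun T => T u) (hcomm n); exact this
        rwa [e]
      have c : ‖R u‖ ^ 2 ≤ ‖R (((1 + R) ^ n) u)‖ ^ 2 := by gcongr
      rw [Nat.cast_succ, add_mul, one_mul]
      linarith
  have hz : X = 0 := by
    ext w
    apply hinj
    set u := X w with hu
    have hb : ∀ n : ℕ, n * ‖R u‖ ^ 2 ≤ (‖X‖ * ‖w‖) ^ 2 := by
      intro n
      refine (hlow n u).trans ?_
      have e : ((1 + R) ^ n) u = X (((1 - R) ^ n) w) := by
        have := congrArg (fun T => T w) (hpow n); exact this
      rw [e]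
      have : ‖X (((1 - R) ^ n) w)‖ ≤ ‖X‖ * ‖w‖ := by
        refine (X.le_opNorm _).trans ?_
        gcongr; exact hmn n w
      gcongr
    by_contra hne
    have hpos' : 0 < ‖R u‖ ^ 2 := by have := norm_pos_iff.2 hne; positivity
    obtain ⟨n, hn⟩ := exists_nat_gt ((‖X‖ * ‖w‖) ^ 2 / ‖R u‖ ^ 2)
    rw [div_lt_iff₀ hpos'] at hn
    linarith [hb n]
  exact sub_eq_zero.1 hz

end

section

theorem J_re (J : H ≃ₗᵢ⋆[ℂ] H) (a b : H) : (⟪J a, J b⟫_ℂ).re = (⟪a, b⟫_ℂ).re := by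
  have h1 := re_inner_eq_norm_add_mul_self_sub_norm_sub_mul_self_div_four (𝕜 := ℂ) (J a) (J b)
  have h2 := re_inner_eq_norm_add_mul_self_sub_norm_sub_mul_self_div_four (𝕜 := ℂ) a b
  rw [← map_add, ← map_sub, J.norm_map, J.norm_map, ← h2] at h1
  exact h1

theorem J_I (J : H ≃ₗᵢ⋆[ℂ] H) (a : H) : J (Complex.I • a) = - (Complex.I • J a) := by
  rw [map_smulₛₗ]; simp

theorem J_inner (J : H ≃ₗᵢ⋆[ℂ] H) (a b : H) : ⟪J a, J b⟫_ℂ = ⟪b, a⟫_ℂ := by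
  rw [← inner_conj_symm b a]
  apply Complex.ext
  · rw [inner_conj_symm, J_re]; exact inner_re_symm (𝕜 := ℂ) _ _
  · rw [inner_conj_symm]
    have h3 : (⟪b, a⟫_ℂ).im = - (⟪a, b⟫_ℂ).im := inner_im_symm (𝕜 := ℂ) _ _
    have := J_re J a (Complex.I • b)
    rw [J_I, inner_neg_right, inner_smul_right, inner_smul_right] at this
    simp at this ⊢
    linarith

theorem J_symm {J : H ≃ₗᵢ⋆[ℂ] H} (hJ : ∀ v, J (J v) = v) (v : H) : J.symm v = J v := by
  rw [LinearIsometryEquiv.symm_apply_eq, hJ]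

theorem conjJ_apply {J : H ≃ₗᵢ⋆[ℂ] H} (hJ : ∀ v, J (J v) = v) (T : BH H) (v : H) :
    conjJ J T v = J (T (J v)) := by
  show J (T (J.symm v)) = _
  rw [J_symm hJ]

theorem conjJ_star {J : H ≃ₗᵢ⋆[ℂ] H} (hJ : ∀ v, J (J v) = v) (T : BH H) :
    star (conjJ J T) = conjJ J (star T) := by
  symm
  rw [ContinuousLinearMap.star_eq_adjoint (A := conjJ J T), ContinuousLinearMap.eq_adjoint_iff]
  intro a b
  rw [conjJ_apply hJ, conjJ_apply hJ]
  rw [← hJ b, J_inner, hJ b]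
  conv_rhs => rw [← hJ a]
  rw [J_inner]
  rw [inner_star]
  

theorem conjJ_mul {J : H ≃ₗᵢ⋆[ℂ] H} (hJ : ∀ v, J (J v) = v) (T S : BH H) :
    conjJ J (T * S) = conjJ J T * conjJ J S := by
  ext v
  rw [mul_apply_eq_comp, conjJ_apply hJ, conjJ_apply hJ, conjJ_apply hJ, hJ]; rfl

theorem conjJ_conjJ {J : H ≃ₗᵢ⋆[ℂ] H} (hJ : ∀ v, J (J v) = v) (T : BH H) :
    conjJ J (conjJ J T) = T := by
  ext v
  rw [conjJ_apply hJ, conjJ_apply hJ, hJ, hJ]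

theorem conjJ_add (J : H ≃ₗᵢ⋆[ℂ] H) (T S : BH H) :
    conjJ J (T + S) = conjJ J T + conjJ J S := by
  ext v
  show J (T _ + S _) = J _ + J _
  rw [map_add]

theorem conjJ_one (J : H ≃ₗᵢ⋆[ℂ] H) : conjJ J (1 : BH H) = 1 := by
  ext v
  show J (J.symm v) = v
  simp

def Jr (J : H ≃ₗᵢ⋆[ℂ] H) : H →L[ℝ] H where
  toFun := J
  map_add' := by simp
  map_smul' := by
    intro c v
    rw [← Complex.coe_smul, map_smulₛₗ]
    simp
  cont := J.continuous

def Ur (J : H ≃ₗᵢ⋆[ℂ] H) (hJ : ∀ v, J (J v) = v) : H ≃ₗᵢ[ℝ] H where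
  toFun := fun v => Complex.I • J v
  invFun := fun v => Complex.I • J v
  left_inv := by intro v; simp [J_I, smul_smul, hJ]
  right_inv := by intro v; simp [J_I, smul_smul, hJ]
  map_add' := by simp
  map_smul' := by
    intro c v
    have := (Jr J).map_smul c v
    change J (c • v) = c • J v at this
    simp only [this]
    exact smul_comm _ _ _
  norm_map' := by intro v; simp [norm_smul]

theorem sa_dense (M : VonNeumannAlgebra H) (ξ d : H)
    (hd : Dense {η : H | ∃ x ∈ (M : Set (BH H)), x ξ = η})
    (h : ∀ x ∈ (M : Set (BH H)), star x = x → ⟪x ξ, d⟫_ℂ = 0) : d = 0 := by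
  refine hd.eq_zero_of_inner_right ℂ ?_
  rintro _ ⟨x, hx, rfl⟩
  obtain ⟨a, b, ha, hb, e, ea, eb⟩ := sa_decomp x
  have hxs : star x ∈ M := star_mem hx
  have ham : a ∈ (M : Set (BH H)) := by
    rw [ea]; exact M.toStarSubalgebra.smul_mem (add_mem hx hxs) _
  have hbm : b ∈ (M : Set (BH H)) := by
    rw [eb]; exact M.toStarSubalgebra.smul_mem (sub_mem hx hxs) _
  simp only [e, _root_.add_apply, _root_.smul_apply, inner_add_left, inner_smul_left, h a ham ha, h b hbm hb]
  simp

def Ksa (M : VonNeumannAlgebra H) (ξ : H) : Submodule ℝ H where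
  carrier := {η | ∃ x ∈ (M : Set (BH H)), star x = x ∧ x ξ = η}
  add_mem' := by
    rintro _ _ ⟨x, hx, sx, rfl⟩ ⟨y, hy, sy, rfl⟩
    exact ⟨x + y, add_mem hx hy, by rw [star_add, sx, sy], rfl⟩
  zero_mem' := ⟨0, zero_mem M, by simp, rfl⟩
  smul_mem' := by
    rintro c _ ⟨x, hx, sx, rfl⟩
    refine ⟨(c : ℂ) • x, M.toStarSubalgebra.smul_mem hx _, by simp [sx], ?_⟩
    simp

section
attribute [local instance] InnerProductSpace.complexToReal

theorem J_comm (M : VonNeumannAlgebra H) (J : H ≃ₗᵢ⋆[ℂ] H) (hJ : ∀ v, J (J v) = v) (ξ : H)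
    (hJξ : J ξ = ξ) (hcomm : Set.centralizer (M : Set (BH H)) = conjJ J '' (M : Set (BH H)))
    (hd : Dense {η : H | ∃ x ∈ (M : Set (BH H)), x ξ = η})
    (hpos : ∀ x ∈ (M : Set (BH H)), star x = x → 0 ≤ (⟪x ξ, J (x ξ)⟫_ℂ).re)
    (p : BH H) (hp : star p = p)
    (hpM : ∀ x ∈ (M : Set (BH H)), star x = x → ∃ y ∈ (M : Set (BH H)), star y = y ∧ p (x ξ) = y ξ)
    (v : H) : J (p v) = p (J v) := by
  set K : Submodule ℝ H := (Ksa M ξ).topologicalClosure with hK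
  have hcl : IsClosed (K : Set H) := Submodule.isClosed_topologicalClosure _
  have : CompleteSpace K := hcl.completeSpace_coe
  set P := K.starProjection with hP
  have hmemK : ∀ x ∈ (M : Set (BH H)), star x = x → x ξ ∈ K := fun x hx sx =>
    Submodule.le_topologicalClosure _ ⟨x, hx, sx, rfl⟩
  have hind : ∀ S : Set H, IsClosed S → (∀ x ∈ (M : Set (BH H)), star x = x → x ξ ∈ S) → ∀ k ∈ K, k ∈ S := by
    intro S hS h k hk
    exact closure_minimal (s := (Ksa M ξ : Set H)) (by rintro _ ⟨x, hx, sx, rfl⟩; exact h x hx sx) hS hk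
  have reinner : ∀ a b : H, ⟪a, b⟫_ℝ = (⟪a, b⟫_ℂ).re := fun a b => rfl
  have F1 : ∀ k ∈ K, p k ∈ K := by
    refine hind {k | p k ∈ K} (hcl.preimage p.continuous) ?_
    intro x hx sx
    obtain ⟨y, hy, sy, e⟩ := hpM x hx sx
    show p (x ξ) ∈ K
    rw [e]; exact hmemK y hy sy
  have F2 : ∀ v, P (p v) = p (P v) := by
    intro v
    refine Submodule.eq_starProjection_of_mem_of_inner_eq_zero (K := K) ?_ ?_
    · exact F1 _ (Submodule.starProjection_apply_mem _ _)
    · intro w hw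
      rw [← map_sub, reinner, sa_inner hp, ← reinner]
      exact Submodule.starProjection_inner_eq_zero _ _ (F1 w hw)
  have F3 : ∀ k ∈ K, ∀ l ∈ K, (⟪k, J l⟫_ℂ).im = 0 := by
    refine hind {k | ∀ l ∈ K, (⟪k, J l⟫_ℂ).im = 0} ?_ ?_
    · simp only [Set.setOf_forall]
      refine isClosed_iInter fun l => isClosed_iInter fun _ => ?_
      exact isClosed_eq (Complex.continuous_im.comp (continuous_id.inner continuous_const)) continuous_const
    · intro x hx sx
      refine hind {l | (⟪x ξ, J l⟫_ℂ).im = 0} ?_ ?_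
      · exact isClosed_eq (Complex.continuous_im.comp (continuous_const.inner J.continuous)) continuous_const
      · intro y hy sy
        show (⟪x ξ, J (y ξ)⟫_ℂ).im = 0
        have hy' : conjJ J y ∈ Set.centralizer (M : Set (BH H)) := by rw [hcomm]; exact ⟨y, hy, rfl⟩
        have e : J (y ξ) = conjJ J y ξ := by rw [conjJ_apply hJ, hJξ]
        have c := congrArg (fun T => T ξ) ((Set.mem_centralizer_iff.1 hy') x hx)
        simp only [mul_apply_eq_comp] at c
        have s' : star (conjJ J y) = conjJ J y := by rw [conjJ_star hJ, sy]
        have : (starRingEnd ℂ) ⟪x ξ, J (y ξ)⟫_ℂ = ⟪x ξ, J (y ξ)⟫_ℂ := by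
          rw [inner_conj_symm, e, sa_inner s', sa_inner sx, c]
        exact Complex.conj_eq_iff_im.1 this
  have F4 : ∀ d : H, (∀ k ∈ K, (⟪k, d⟫_ℂ).re = 0) → (∀ k ∈ K, (⟪d, J k⟫_ℂ).im = 0) → d = 0 := by
    intro d h1 h2
    refine rvd M ξ d hd (fun x hx sx => h1 _ (hmemK x hx sx)) ?_
    intro y hy sy
    rw [hcomm] at hy
    obtain ⟨x, hx, rfl⟩ := hy
    have sx : star x = x := by
      rw [← conjJ_conjJ hJ (star x), ← conjJ_star hJ, sy, conjJ_conjJ hJ]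
    rw [conjJ_apply hJ, hJξ]
    exact h2 _ (hmemK x hx sx)
  have F5 : ∀ v : H, (∀ k ∈ K, (⟪k, v⟫_ℂ).re = 0) → ∃ k ∈ K, v = Complex.I • J k := by
    intro v hv
    let U := Ur J hJ
    let K' : Submodule ℝ H := K.map (U.toLinearEquiv : H →ₗ[ℝ] H)
    have hU : ∀ k, U k = Complex.I • J k := fun _ => rfl
    have hKK' : ∀ k ∈ K, U k ∈ K' := fun k hk => ⟨k, hk, rfl⟩
    have hd0 : v - K'.starProjection v = 0 := by
      apply F4
      · intro k hk
        rw [inner_sub_right, Complex.sub_re, hv k hk]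
        obtain ⟨l, hl, e⟩ := Submodule.starProjection_apply_mem K' v
        rw [← e]
        change 0 - (⟪k, Complex.I • J l⟫_ℂ).re = 0
        rw [inner_smul_right]
        simp [F3 k hk l hl]
      · intro k hk
        have := Submodule.starProjection_inner_eq_zero (K := K') v _ (hKK' k hk)
        rw [reinner, hU, inner_smul_right] at this
        simp only [Complex.mul_re, Complex.I_re, Complex.I_im, zero_mul, one_mul, zero_sub,
          neg_eq_zero] at this
        exact this
    obtain ⟨l, hl, e⟩ := Submodule.starProjection_apply_mem K' v
    refine ⟨l, hl, ?_⟩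
    rw [sub_eq_zero] at hd0
    rw [hd0, ← e]; rfl
  have Pperp : ∀ v, ∀ k ∈ K, (⟪k, v - P v⟫_ℂ).re = 0 := by
    intro v k hk
    have := Submodule.starProjection_inner_eq_zero (K := K) v k hk
    rw [real_inner_comm] at this
    exact this
  have Pfix : ∀ k ∈ K, P k = k := fun k hk => Submodule.starProjection_eq_self_iff.2 hk
  have Pzero : ∀ v, (∀ k ∈ K, (⟪k, v⟫_ℂ).re = 0) → P v = 0 := by
    intro v hv
    rw [Submodule.starProjection_apply_eq_zero_iff, Submodule.mem_orthogonal]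
    intro u hu; exact hv u hu
  have Pmem : ∀ v, P v ∈ K := fun v => Submodule.starProjection_apply_mem _ _
  have F6 : ∀ v, J (P (J v)) = v + Complex.I • P (Complex.I • v) := by
    intro v
    obtain ⟨k, hk, e⟩ := F5 (Complex.I • v - P (Complex.I • v)) (Pperp _)
    have e1 : v = J k - Complex.I • P (Complex.I • v) := by
      have := congrArg (fun w => -(Complex.I • w)) e
      simp only [smul_sub, smul_smul, Complex.I_mul_I, neg_smul, one_smul, neg_neg] at this
      rw [← this]; abel
    have e2 : J v = k + Complex.I • J (P (Complex.I • v)) := by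
      conv_lhs => rw [e1]
      rw [map_sub, hJ, J_I, sub_neg_eq_add]
    have e3 : P (J v) = k := by
      rw [e2, map_add, Pfix k hk, Pzero, add_zero]
      intro l hl
      rw [inner_smul_right]
      simp [F3 l hl _ (Pmem (Complex.I • v))]
    rw [e3]
    exact (sub_eq_iff_eq_add.1 e1.symm)
  have F7 : ∀ v, p (J (P (J v))) = J (P (J (p v))) := by
    intro v
    rw [F6, F6, map_add, map_smul, ← F2, map_smul]
  have F8 : ∀ d : H, (∀ k ∈ K, (⟪k, d⟫_ℂ).re = 0) → (∀ k ∈ K, (⟪k, d⟫_ℂ).im = 0) → d = 0 := by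
    intro d h1 h2
    refine sa_dense M ξ d hd ?_
    intro x hx sx
    exact Complex.ext (h1 _ (hmemK x hx sx)) (h2 _ (hmemK x hx sx))
  let R : K →L[ℝ] K := ((P.comp (Jr J)).comp K.subtypeL).codRestrict K (fun k => Pmem _)
  let q : K →L[ℝ] K := ((p.restrictScalars ℝ).comp K.subtypeL).codRestrict K (fun k => F1 _ k.2)
  have hR : ∀ k : K, (R k : H) = P (J k) := fun k => rfl
  have hq : ∀ k : K, (q k : H) = p k := fun k => rfl
  have Psym : ∀ a, ∀ k ∈ K, (⟪k, P a⟫_ℂ).re = (⟪k, a⟫_ℂ).re := by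
    intro a k hk
    have := Pperp a k hk
    rw [inner_sub_right, Complex.sub_re] at this
    linarith
  have key := lemE R q ?_ ?_ ?_ ?_ ?_
  · have F9 : ∀ k ∈ K, J (p k) = p (J k) := by
      intro k hk
      have e : P (J (p k)) = p (P (J k)) := by
        have := congrArg (fun T => ((T ⟨k, hk⟩ : K) : H)) key
        exact this
      rw [← sub_eq_zero]
      apply F8
      · intro l hl
        rw [← Psym _ l hl, map_sub, e, F2, sub_self, inner_zero_right]; rfl
      · intro l hl
        rw [inner_sub_right, Complex.sub_im, F3 l hl _ (F1 k hk), ← sa_inner hp, F3 _ (F1 l hl) k hk, sub_zero]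
    have hcl2 : IsClosed {v | J (p v) = p (J v)} :=
      isClosed_eq (J.continuous.comp p.continuous) (p.continuous.comp J.continuous)
    have := closure_minimal (s := {η : H | ∃ x ∈ (M : Set (BH H)), x ξ = η}) (t := {v | J (p v) = p (J v)}) (by
      rintro _ ⟨x, hx, rfl⟩
      obtain ⟨a, b, ha, hb, e, ea, eb⟩ := sa_decomp x
      have hxs : star x ∈ M := star_mem hx
      have ham : a ∈ (M : Set (BH H)) := by
        rw [ea]; exact M.toStarSubalgebra.smul_mem (add_mem hx hxs) _
      have hbm : b ∈ (M : Set (BH H)) := by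
        rw [eb]; exact M.toStarSubalgebra.smul_mem (sub_mem hx hxs) _
      show J (p (x ξ)) = p (J (x ξ))
      rw [e]
      simp only [_root_.add_apply, _root_.smul_apply, map_add, map_smul, J_I, map_neg]
      rw [F9 _ (hmemK a ham ha), F9 _ (hmemK b hbm hb)]) hcl2
    rw [hd.closure_eq] at this
    exact this (Set.mem_univ v)
  · intro k l
    have a1 : ⟪R k, l⟫_ℝ = (⟪(l : H), J k⟫_ℂ).re := by
      rw [real_inner_comm]
      exact Psym _ _ l.2
    have a2 : ⟪k, R l⟫_ℝ = (⟪(k : H), J l⟫_ℂ).re := Psym _ _ k.2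
    rw [a1, a2]
    conv_lhs => rw [← hJ (l : H), J_inner]
  · intro k
    have a2 : ⟪k, R k⟫_ℝ = (⟪(k : H), J k⟫_ℂ).re := Psym _ _ k.2
    rw [a2]
    refine hind {k | 0 ≤ (⟪k, J k⟫_ℂ).re} ?_ hpos _ k.2
    exact isClosed_le continuous_const (Complex.continuous_re.comp (continuous_id.inner J.continuous))
  · intro k
    show ‖P (J k)‖ ≤ ‖(k : H)‖
    refine (Submodule.norm_starProjection_apply_le K _).trans ?_
    rw [J.norm_map]
  · intro k hk
    have h0 : P (J k) = 0 := congrArg Subtype.val hk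
    have : J k = 0 := by
      apply F8
      · intro l hl
        rw [← Psym _ l hl, h0, inner_zero_right]; rfl
      · intro l hl
        exact F3 l hl k k.2
    have h2 : (k : H) = 0 := by rw [← hJ (k : H), this, map_zero]
    exact Subtype.ext h2
  · ext k
    show P (J (P (J (p k)))) = p (P (J (P (J k))))
    rw [← F7, F2]
end

end

section

structure Ctx (M : VonNeumannAlgebra H) (J : H ≃ₗᵢ⋆[ℂ] H) (Bt : Set (BH H)) (E : BH H → BH H)
    (ξ : H) (p : BH H) : Prop where
  hJ : ∀ v, J (J v) = v
  hJξ : J ξ = ξ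
  comm : Set.centralizer (M : Set (BH H)) = conjJ J '' (M : Set (BH H))
  dense : Dense {η : H | ∃ x ∈ (M : Set (BH H)), x ξ = η}
  pos : ∀ x ∈ (M : Set (BH H)), star x = x → 0 ≤ (⟪x ξ, J (x ξ)⟫_ℂ).re
  one : 1 ∈ Bt
  mul : ∀ x ∈ Bt, ∀ y ∈ Bt, x * y ∈ Bt
  stm : ∀ x ∈ Bt, star x ∈ Bt
  ce : IsCondExp (M : Set (BH H)) Bt E
  hE : ∀ x ∈ (M : Set (BH H)), ⟪ξ, (E x) ξ⟫_ℂ = ⟪ξ, x ξ⟫_ℂ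
  psa : star p = p
  pp : p * p = p
  range : ∀ η : H, p η ∈ closure {η : H | ∃ b ∈ Bt, b ξ = η}
  fix : ∀ η ∈ closure {η : H | ∃ b ∈ Bt, b ξ = η}, p η = η

namespace Ctx
variable {M : VonNeumannAlgebra H} {J : H ≃ₗᵢ⋆[ℂ] H} {Bt : Set (BH H)} {E : BH H → BH H}
    {ξ : H} {p : BH H}

theorem p_fix (h : Ctx M J Bt E ξ p) {b : BH H} (hb : b ∈ Bt) : p (b ξ) = b ξ :=
  h.fix _ (subset_closure ⟨b, hb, rfl⟩)

theorem p_xi (h : Ctx M J Bt E ξ p) : p ξ = ξ := h.p_fix h.one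

theorem ext_dense (h : Ctx M J Bt E ξ p) {S T : BH H}
    (hST : ∀ x ∈ (M : Set (BH H)), S (x ξ) = T (x ξ)) : S = T := by
  ext v
  have := closure_minimal (s := {η : H | ∃ x ∈ (M : Set (BH H)), x ξ = η}) (t := {v | S v = T v})
    (by rintro _ ⟨x, hx, rfl⟩; exact hST x hx) (isClosed_eq S.continuous T.continuous)
  rw [h.dense.closure_eq] at this
  exact this (Set.mem_univ v)

theorem p_apply (h : Ctx M J Bt E ξ p) {x : BH H} (hx : x ∈ (M : Set (BH H))) :
    p (x ξ) = E x ξ := by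
  set w := x ξ - E x ξ with hw
  have h1 : ∀ u ∈ closure {η : H | ∃ b ∈ Bt, b ξ = η}, ⟪u, w⟫_ℂ = 0 := by
    intro u hu
    refine closure_minimal (t := {u | ⟪u, w⟫_ℂ = 0}) ?_
      (isClosed_eq (continuous_id.inner continuous_const) continuous_const) hu
    rintro _ ⟨b, hb, rfl⟩
    show ⟪b ξ, x ξ - E x ξ⟫_ℂ = 0
    have hbx : star b * x ∈ (M : Set (BH H)) := mul_mem (h.ce.subset (h.stm b hb)) hx
    have e1 := h.hE _ hbx
    have e2 := h.ce.bimod _ (h.stm b hb) 1 h.one x hx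
    rw [mul_one, mul_one] at e2
    rw [e2, mul_apply_eq_comp, mul_apply_eq_comp, inner_star, inner_star] at e1
    rw [inner_sub_right, e1, sub_self]
  have h2 : p w = 0 := by
    rw [← inner_self_eq_zero (𝕜 := ℂ), ← sa_inner h.psa, h1]
    exact h.range _
  have h3 := h.p_fix (h.ce.maps_to x hx)
  rw [hw, map_sub, h3, sub_eq_zero] at h2
  exact h2

theorem p_comm (h : Ctx M J Bt E ξ p) {b : BH H} (hb : b ∈ Bt) : p * b = b * p := by
  apply h.ext_dense
  intro x hx
  have e := h.ce.bimod _ hb 1 h.one x hx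
  rw [mul_one, mul_one] at e
  rw [mul_apply_eq_comp, mul_apply_eq_comp, h.p_apply hx, ← mul_apply_eq_comp b, ← mul_apply_eq_comp b, ← e]
  exact h.p_apply (mul_mem (h.ce.subset hb) hx)

theorem E_sa (h : Ctx M J Bt E ξ p) {x : BH H} (hx : x ∈ (M : Set (BH H))) (sx : star x = x) :
    star (E x) = E x := by
  have hsx : IsSelfAdjoint x := sx
  have h1 : (1 : BH H) ∈ (M : Set (BH H)) := one_mem M
  have hc1 : (‖x‖ : ℂ) • (1 : BH H) ∈ (M : Set (BH H)) := M.toStarSubalgebra.smul_mem h1 _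
  have hc : (‖x‖ : ℂ) • (1 : BH H) - x ∈ (M : Set (BH H)) := sub_mem hc1 hx
  have hp : 0 ≤ (‖x‖ : ℂ) • (1 : BH H) - x := by
    rw [sub_nonneg]
    have := hsx.le_algebraMap_norm_self
    rw [Algebra.algebraMap_eq_smul_one] at this
    rwa [Complex.coe_smul]
  have hE1 := (IsSelfAdjoint.of_nonneg (h.ce.pos _ hc hp)).star_eq
  have e : (‖x‖ : ℂ) • (1 : BH H) = ((‖x‖ : ℂ) • (1 : BH H) - x) + x := by abel
  have e2 := h.ce.map_add _ hc _ hx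
  rw [← e, h.ce.map_smul _ _ h1, h.ce.fixes _ h.one] at e2
  have e3 : E x = (‖x‖ : ℂ) • (1 : BH H) - E ((‖x‖ : ℂ) • (1 : BH H) - x) :=
    eq_sub_of_add_eq' e2.symm
  rw [e3, star_sub, hE1, star_smul]
  simp

theorem Jp (h : Ctx M J Bt E ξ p) (v : H) : J (p v) = p (J v) :=
  J_comm M J h.hJ ξ h.hJξ h.comm h.dense h.pos p h.psa
    (fun x hx sx => ⟨E x, h.ce.subset (h.ce.maps_to x hx), h.E_sa hx sx, h.p_apply hx⟩) v

theorem conj_mem (h : Ctx M J Bt E ξ p) {x : BH H} (hx : x ∈ (M : Set (BH H))) :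
    conjJ J x ∈ Set.centralizer (M : Set (BH H)) := by rw [h.comm]; exact ⟨x, hx, rfl⟩

theorem N_iff {T : BH H} : T ∈ basicConstruction J Bt ↔ ∀ b ∈ Bt, conjJ J b * T = T * conjJ J b := by
  simp [basicConstruction, Set.mem_centralizer_iff]

theorem M_sub_N (h : Ctx M J Bt E ξ p) {x : BH H} (hx : x ∈ (M : Set (BH H))) :
    x ∈ basicConstruction J Bt := by
  rw [N_iff]
  intro b hb
  exact ((Set.mem_centralizer_iff.1 (h.conj_mem (h.ce.subset hb))) x hx).symm

theorem p_mem (h : Ctx M J Bt E ξ p) : p ∈ basicConstruction J Bt := by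
  rw [N_iff]
  intro b hb
  ext v
  rw [mul_apply_eq_comp, mul_apply_eq_comp, conjJ_apply h.hJ, conjJ_apply h.hJ, h.Jp v, ← h.Jp (b _)]
  exact congrArg (fun T : BH H => J (T (J v))) (h.p_comm hb).symm

theorem star_N (h : Ctx M J Bt E ξ p) {T : BH H} (hT : T ∈ basicConstruction J Bt) :
    star T ∈ basicConstruction J Bt := by
  rw [N_iff] at *
  intro b hb
  have := congrArg star (hT _ (h.stm b hb))
  rw [star_mul, star_mul, conjJ_star h.hJ, star_star] at this
  exact this.symm

theorem add_N {T S : BH H} (hT : T ∈ basicConstruction J Bt) (hS : S ∈ basicConstruction J Bt) :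
    T + S ∈ basicConstruction J Bt := by
  rw [N_iff] at *
  intro b hb
  rw [mul_add, add_mul, hT b hb, hS b hb]

theorem sub_N {T S : BH H} (hT : T ∈ basicConstruction J Bt) (hS : S ∈ basicConstruction J Bt) :
    T - S ∈ basicConstruction J Bt := by
  rw [N_iff] at *
  intro b hb
  rw [mul_sub, sub_mul, hT b hb, hS b hb]

theorem mul_N {T S : BH H} (hT : T ∈ basicConstruction J Bt) (hS : S ∈ basicConstruction J Bt) :
    T * S ∈ basicConstruction J Bt := Set.mul_mem_centralizer hT hS

theorem one_N : (1 : BH H) ∈ basicConstruction J Bt := Set.one_mem_centralizer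

theorem smul_N (c : ℂ) {T : BH H} (hT : T ∈ basicConstruction J Bt) :
    c • T ∈ basicConstruction J Bt := by
  rw [N_iff] at *
  intro b hb
  rw [mul_smul_comm, smul_mul_assoc, hT b hb]

theorem sqrt_N {T : BH H} (hT : T ∈ basicConstruction J Bt) : CFC.sqrt T ∈ basicConstruction J Bt := by
  rw [N_iff] at *
  intro b hb
  exact (commute_sqrt (hT b hb).symm).symm

theorem pyp (h : Ctx M J Bt E ξ p) {y : BH H} (hy : y ∈ (M : Set (BH H))) : p * y * p = E y * p := by
  apply h.ext_dense
  intro z hz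
  have hEz := h.ce.maps_to z hz
  rw [mul_apply_eq_comp, mul_apply_eq_comp, mul_apply_eq_comp, h.p_apply hz]
  have e := h.ce.bimod 1 h.one _ hEz y hy
  rw [one_mul, one_mul] at e
  rw [← mul_apply_eq_comp (E y), ← mul_apply_eq_comp y, ← e]
  exact h.p_apply (mul_mem hy (h.ce.subset hEz))

theorem pJyp (h : Ctx M J Bt E ξ p) {y : BH H} (hy : y ∈ (M : Set (BH H))) :
    p * conjJ J y * p = conjJ J (E y) * p := by
  ext v
  simp only [mul_apply_eq_comp, conjJ_apply h.hJ]
  rw [← h.Jp, h.Jp v]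
  congr 1
  exact congrArg (fun T => T (J v)) (h.pyp hy)

theorem conjJ_nonneg (h : Ctx M J Bt E ξ p) {y : BH H} (hy : 0 ≤ y) : 0 ≤ conjJ J y := by
  rw [nonneg_iff_inner] at *
  intro v
  rw [conjJ_apply h.hJ]
  have e : ⟪v, J (y (J v))⟫_ℂ = ⟪y (J v), J v⟫_ℂ := by
    conv_lhs => rw [← h.hJ v]
    rw [J_inner, h.hJ v]
  rw [e, ← inner_conj_symm]
  exact star_nonneg_iff.2 (hy (J v))

theorem rlem (h : Ctx M J Bt E ξ p) {x : BH H} (hx : x ∈ (M : Set (BH H))) :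
    ∃ r : BH H, (∀ t ∈ basicConstruction J Bt, r * t = t * r) ∧
      ∀ u w, p u = u → p w = w → ⟪conjJ J x u, conjJ J x w⟫_ℂ = ⟪r u, r w⟫_ℂ := by
  have hxx : star x * x ∈ (M : Set (BH H)) := mul_mem (star_mem hx) hx
  have hpos : 0 ≤ conjJ J (E (star x * x)) :=
    h.conjJ_nonneg (h.ce.pos _ hxx (star_mul_self_nonneg x))
  refine ⟨CFC.sqrt (conjJ J (E (star x * x))), ?_, ?_⟩
  · intro t ht
    apply commute_sqrt
    exact N_iff.1 ht _ (h.ce.maps_to _ hxx)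
  · intro u w hu hw
    rw [sa_inner (sqrt_sa _), ← mul_apply_eq_comp, CFC.sqrt_mul_sqrt_self _ hpos]
    conv_rhs => rw [← hw]
    rw [← mul_apply_eq_comp, ← h.pJyp hxx, conjJ_mul h.hJ, ← conjJ_star h.hJ]
    simp only [mul_apply_eq_comp]
    rw [← sa_inner h.psa, hu, hw, inner_star]

theorem dense' (h : Ctx M J Bt E ξ p) :
    Dense {η : H | ∃ x ∈ (M : Set (BH H)), conjJ J x ξ = η} := by
  have : {η : H | ∃ x ∈ (M : Set (BH H)), conjJ J x ξ = η} = J '' {η : H | ∃ x ∈ (M : Set (BH H)), x ξ = η} := by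
    ext η
    constructor
    · rintro ⟨x, hx, rfl⟩
      exact ⟨x ξ, ⟨x, hx, rfl⟩, by rw [conjJ_apply h.hJ, h.hJξ]⟩
    · rintro ⟨_, ⟨x, hx, rfl⟩, rfl⟩
      exact ⟨x, hx, by rw [conjJ_apply h.hJ, h.hJξ]⟩
  rw [this]
  exact J.surjective.denseRange.dense_image J.continuous h.dense

theorem ext_dense' (h : Ctx M J Bt E ξ p) {S T : BH H}
    (hST : ∀ x ∈ (M : Set (BH H)), S (conjJ J x ξ) = T (conjJ J x ξ)) : S = T := by
  ext v
  have := closure_minimal (s := {η : H | ∃ x ∈ (M : Set (BH H)), conjJ J x ξ = η}) (t := {v | S v = T v})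
    (by rintro _ ⟨x, hx, rfl⟩; exact hST x hx) (isClosed_eq S.continuous T.continuous)
  rw [h.dense'.closure_eq] at this
  exact this (Set.mem_univ v)

theorem lemB (h : Ctx M J Bt E ξ p) {t : BH H} (ht : t ∈ basicConstruction J Bt)
    (htp : p * t * p = t) : ∃ b ∈ Bt, b * p = t := by
  have pt : p * t = t := by rw [← htp, ← mul_assoc, ← mul_assoc, h.pp]
  have tp : t * p = t := by rw [← htp, mul_assoc, h.pp]
  have ptξ : p (t ξ) = t ξ := by rw [← mul_apply_eq_comp, pt]
  let ev : H → (M.commutant.toStarSubalgebra →ₗ[ℂ] H) := fun v =>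
    { toFun := fun x => (x : BH H) v, map_add' := fun _ _ => rfl, map_smul' := fun _ _ => rfl }
  have hM' : ∀ y : M.commutant.toStarSubalgebra, ∃ x ∈ (M : Set (BH H)), conjJ J x = y := by
    intro y
    have : (y : BH H) ∈ Set.centralizer (M : Set (BH H)) := by
      rw [← VonNeumannAlgebra.coe_commutant]; exact y.2
    rw [h.comm] at this
    exact this
  have hM'2 : ∀ x ∈ (M : Set (BH H)), conjJ J x ∈ M.commutant := by
    intro x hx
    rw [← SetLike.mem_coe, VonNeumannAlgebra.coe_commutant]; exact h.conj_mem hx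
  have hdr : DenseRange (ev ξ) := by
    refine h.dense'.mono ?_
    rintro _ ⟨x, hx, rfl⟩
    exact ⟨⟨conjJ J x, hM'2 x hx⟩, rfl⟩
  have hbd : ∀ y, ‖ev (t ξ) y‖ ≤ ‖t‖ * ‖ev ξ y‖ := by
    intro y
    obtain ⟨x, hx, e⟩ := hM' y
    show ‖(y : BH H) (t ξ)‖ ≤ ‖t‖ * ‖(y : BH H) ξ‖
    rw [← e]
    obtain ⟨r, hr, hr2⟩ := h.rlem hx
    have n1 : ∀ u, p u = u → ‖conjJ J x u‖ = ‖r u‖ := by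
      intro u hu
      have := hr2 u u hu hu
      rw [inner_self_c, inner_self_c] at this
      exact (sq_eq_sq₀ (norm_nonneg _) (norm_nonneg _)).1 (by exact_mod_cast this)
    rw [n1 _ ptξ, n1 _ h.p_xi, ← mul_apply_eq_comp, hr t ht]
    exact t.le_opNorm _
  let b : BH H := (ev (t ξ)).extendOfNorm (ev ξ)
  have hb : ∀ y ∈ Set.centralizer (M : Set (BH H)), b (y ξ) = y (t ξ) := by
    intro y hy
    have hy' : y ∈ M.commutant := by
      rw [← SetLike.mem_coe, VonNeumannAlgebra.coe_commutant]; exact hy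
    exact LinearMap.extendOfNorm_eq (f := ev (t ξ)) (e := ev ξ) hdr ⟨_, hbd⟩ ⟨y, hy'⟩
  have hbM : b ∈ (M : Set (BH H)) := by
    have : b ∈ Set.centralizer (Set.centralizer (M : Set (BH H))) := by
      rw [Set.mem_centralizer_iff]
      intro y hy
      apply h.ext_dense'
      intro x hx
      have hx' := h.conj_mem hx
      rw [mul_apply_eq_comp, mul_apply_eq_comp, hb _ hx', ← mul_apply_eq_comp y, ← mul_apply_eq_comp y,
        hb _ (Set.mul_mem_centralizer hy hx')]
    rwa [M.centralizer_centralizer] at this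
  have hbξ : b ξ = t ξ := by
    have := hb 1 Set.one_mem_centralizer
    simpa using this
  have hEb : E b = b := by
    have e0 : E b ξ = b ξ := by rw [← h.p_apply hbM, hbξ, ptξ]
    apply h.ext_dense'
    intro x hx
    have c := Set.mem_centralizer_iff.1 (h.conj_mem hx)
    rw [← mul_apply_eq_comp, ← mul_apply_eq_comp, c b hbM, c _ (h.ce.subset (h.ce.maps_to b hbM)),
      mul_apply_eq_comp, mul_apply_eq_comp, e0]
  have hbB : b ∈ Bt := by rw [← hEb]; exact h.ce.maps_to b hbM
  refine ⟨b, hbB, ?_⟩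
  apply h.ext_dense'
  intro z hz
  have hEz := h.ce.maps_to z hz
  have e1 : p (conjJ J z ξ) = conjJ J (E z) ξ := by
    rw [conjJ_apply h.hJ, conjJ_apply h.hJ, h.hJξ, ← h.Jp, h.p_apply hz]
  rw [mul_apply_eq_comp, e1, hb _ (h.conj_mem (h.ce.subset hEz))]
  conv_rhs => rw [← tp, mul_apply_eq_comp, e1, ← mul_apply_eq_comp, ← N_iff.1 ht _ hEz]
  rfl

theorem lemC (h : Ctx M J Bt E ξ p) {x : BH H} (hx : x ∈ (M : Set (BH H))) :
    ∃ r : BH H, ∀ b ∈ Bt, ⟪conjJ J x ξ, b (conjJ J x ξ)⟫_ℂ = ⟪r ξ, (b * p) (r ξ)⟫_ℂ := by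
  obtain ⟨r, hr, hr2⟩ := h.rlem hx
  refine ⟨r, fun b hb => ?_⟩
  have c := Set.mem_centralizer_iff.1 (h.conj_mem hx) b (h.ce.subset hb)
  have hbp : b * p ∈ basicConstruction J Bt := mul_N (h.M_sub_N (h.ce.subset hb)) h.p_mem
  rw [← mul_apply_eq_comp, c, mul_apply_eq_comp, hr2 ξ (b ξ) h.p_xi (h.p_fix hb)]
  rw [← mul_apply_eq_comp (b * p) r, ← hr _ hbp, mul_apply_eq_comp, mul_apply_eq_comp, h.p_xi]

theorem lemC_pos (h : Ctx M J Bt E ξ p) {b : BH H} (hb : b ∈ Bt) (h0 : 0 ≤ b * p) : 0 ≤ b := by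
  rw [nonneg_iff_inner]
  intro v
  have hcl : IsClosed {v : H | 0 ≤ ⟪v, b v⟫_ℂ} := 
    isClosed_le continuous_const (continuous_id.inner b.continuous)
  have := closure_minimal (s := {η : H | ∃ x ∈ (M : Set (BH H)), conjJ J x ξ = η}) (by
    rintro _ ⟨x, hx, rfl⟩
    obtain ⟨r, hr⟩ := h.lemC hx
    show 0 ≤ ⟪_, b _⟫_ℂ
    rw [hr b hb]
    exact (nonneg_iff_inner _).1 h0 _) hcl
  rw [h.dense'.closure_eq] at this
  exact this (Set.mem_univ v)

end Ctx

end

section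

theorem extLem {L I : Type*} [NormedAddCommGroup L] [InnerProductSpace ℂ L] [CompleteSpace L]
    (g g1 g2 : I → L) (C : ℝ) (hC : 0 ≤ C)
    (hd : (Submodule.span ℂ (Set.range g)).topologicalClosure = ⊤)
    (hi : ∀ i j, ⟪g1 i, g1 j⟫_ℂ + ⟪g2 i, g2 j⟫_ℂ = ((C^2 : ℝ) : ℂ) * ⟪g i, g j⟫_ℂ) :
    ∃ T : L →L[ℂ] L, ∀ i, T (g i) = g1 i := by
  have key : ∀ c : I →₀ ℂ, ‖Finsupp.linearCombination ℂ g1 c‖ ≤ C * ‖Finsupp.linearCombination ℂ g c‖ := by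
    intro c
    have e : ∀ k : I → L, ⟪Finsupp.linearCombination ℂ k c, Finsupp.linearCombination ℂ k c⟫_ℂ
        = ∑ i ∈ c.support, ∑ j ∈ c.support, (starRingEnd ℂ (c j)) * (c i * ⟪k j, k i⟫_ℂ) := by
      intro k
      rw [Finsupp.linearCombination_apply, Finsupp.sum, inner_sum]
      refine Finset.sum_congr rfl fun i _ => ?_
      rw [sum_inner]
      refine Finset.sum_congr rfl fun j _ => ?_
      rw [inner_smul_left, inner_smul_right]
    have h1 : ⟪Finsupp.linearCombination ℂ g1 c, Finsupp.linearCombination ℂ g1 c⟫_ℂ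
        + ⟪Finsupp.linearCombination ℂ g2 c, Finsupp.linearCombination ℂ g2 c⟫_ℂ
        = ((C^2 : ℝ) : ℂ) * ⟪Finsupp.linearCombination ℂ g c, Finsupp.linearCombination ℂ g c⟫_ℂ := by
      rw [e, e, e, Finset.mul_sum, ← Finset.sum_add_distrib]
      refine Finset.sum_congr rfl fun i _ => ?_
      rw [Finset.mul_sum, ← Finset.sum_add_distrib]
      refine Finset.sum_congr rfl fun j _ => ?_
      rw [← mul_add, ← mul_add, hi]; ring
    rw [inner_self_c, inner_self_c, inner_self_c] at h1
    have h2 : ‖Finsupp.linearCombination ℂ g1 c‖^2 + ‖Finsupp.linearCombination ℂ g2 c‖^2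
      = C^2 * ‖Finsupp.linearCombination ℂ g c‖^2 := by exact_mod_cast h1
    refine abs_le_of_sq_le_sq' ?_ (by positivity) |>.2
    rw [mul_pow]; nlinarith [sq_nonneg ‖Finsupp.linearCombination ℂ g2 c‖]
  have hdr : DenseRange (Finsupp.linearCombination ℂ g) := by
    rw [← Finsupp.range_linearCombination] at hd
    rw [DenseRange, dense_iff_closure_eq]
    have := congrArg (fun S : Submodule ℂ L => (S : Set L)) hd
    simpa [LinearMap.coe_range] using this
  refine ⟨LinearMap.extendOfNorm (Finsupp.linearCombination ℂ g1) (Finsupp.linearCombination ℂ g), fun i => ?_⟩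
  have := LinearMap.extendOfNorm_eq (f := Finsupp.linearCombination ℂ g1) hdr ⟨C, key⟩ (Finsupp.single i 1)
  simpa using this

/-- star algebra closed under square roots -/
structure Alg (N : Set (BH H)) : Prop where
  one : 1 ∈ N
  add : ∀ x ∈ N, ∀ y ∈ N, x + y ∈ N
  mul : ∀ x ∈ N, ∀ y ∈ N, x * y ∈ N
  smul : ∀ (c : ℂ), ∀ x ∈ N, c • x ∈ N
  stm : ∀ x ∈ N, star x ∈ N
  sqrt : ∀ x ∈ N, CFC.sqrt x ∈ N

theorem Alg.sub {N : Set (BH H)} (h : Alg N) {x y : BH H} (hx : x ∈ N) (hy : y ∈ N) : x - y ∈ N := by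
  have := h.add x hx _ (h.smul (-1) y hy)
  simpa [sub_eq_add_neg] using this

/-- complement of an operator -/
theorem Alg.compl {N : Set (BH H)} (h : Alg N) {a : BH H} (ha : a ∈ N) :
    ∃ k ∈ N, star a * a + star k * k = ((‖a‖^2 : ℝ) : ℂ) • (1 : BH H) := by
  have h0 : 0 ≤ ((‖a‖^2 : ℝ) : ℂ) • (1 : BH H) - star a * a := by
    rw [nonneg_iff_inner]
    intro v
    rw [_root_.sub_apply, inner_sub_right, _root_.smul_apply, one_apply_eq_self, inner_smul_right,
      mul_apply_eq_comp, inner_star, inner_self_c, inner_self_c]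
    have h3 : ‖a v‖^2 ≤ ‖a‖^2 * ‖v‖^2 := by
      rw [← mul_pow]; exact pow_le_pow_left₀ (norm_nonneg _) (a.le_opNorm v) 2
    have : ((0:ℝ):ℂ) ≤ ((‖a‖^2 * ‖v‖^2 - ‖a v‖^2 : ℝ) : ℂ) := by
      rw [Complex.real_le_real]; linarith
    simpa using this
  refine ⟨CFC.sqrt (((‖a‖^2 : ℝ) : ℂ) • (1 : BH H) - star a * a),
    h.sqrt _ (h.sub (h.smul _ _ h.one) (h.mul _ (h.stm _ ha) _ ha)), ?_⟩
  rw [sqrt_sa, CFC.sqrt_mul_sqrt_self _ h0]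
  abel

theorem cp_one {N : Set (BH H)} {Ψ : BH H → BH H} (hcp : IsCPOn N Ψ) {a : BH H} (ha : a ∈ N) (v : H) :
    0 ≤ ⟪v, Ψ (star a * a) v⟫_ℂ := by
  have := hcp 1 (fun _ => a) (fun _ => ha) (fun _ => v)
  simpa using this

theorem cp_herm0 {N : Set (BH H)} {Ψ : BH H → BH H} (hcp : IsCPOn N Ψ) {a b : BH H}
    (ha : a ∈ N) (hb : b ∈ N) (v w : H) :
    (⟪v, Ψ (star a * b) w⟫_ℂ + ⟪w, Ψ (star b * a) v⟫_ℂ).im = 0 := by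
  have := hcp 2 ![a, b] (by intro i; fin_cases i <;> simpa) ![v, w]
  simp only [Fin.sum_univ_two, Matrix.cons_val_zero, Matrix.cons_val_one] at this
  have h := (Complex.nonneg_iff.1 this).2
  have h1 := (Complex.nonneg_iff.1 (cp_one hcp ha v)).2
  have h2 := (Complex.nonneg_iff.1 (cp_one hcp hb w)).2
  simp only [Complex.add_im] at h ⊢
  linarith

theorem cp_herm {N : Set (BH H)} {Ψ : BH H → BH H} (hcp : IsCPOn N Ψ) {a b : BH H}
    (ha : a ∈ N) (hb : b ∈ N) : star (Ψ (star a * b)) = Ψ (star b * a) := by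
  refine ContinuousLinearMap.ext fun v => ext_inner_left ℂ fun w => ?_
  rw [inner_star, ← inner_conj_symm]
  have h1 := cp_herm0 hcp ha hb v w
  have h2 := cp_herm0 hcp ha hb v (Complex.I • w)
  simp only [map_smul, inner_smul_left, inner_smul_right, Complex.conj_I] at h2
  simp at h1 h2
  apply Complex.ext
  · rw [Complex.conj_re]; linarith
  · rw [Complex.conj_im]; linarith

theorem stine.{u} {H : Type u} [NormedAddCommGroup H] [InnerProductSpace ℂ H] [CompleteSpace H]
    {N : Set (BH H)} {Ψ : BH H → BH H} (hcp : IsCPOn N Ψ) :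
    ∃ (L : Type u) (_ : NormedAddCommGroup L) (_ : InnerProductSpace ℂ L) (_ : CompleteSpace L)
      (V : BH H → H →L[ℂ] L),
      (∀ a ∈ N, ∀ b ∈ N, ∀ v w, ⟪V a v, V b w⟫_ℂ = ⟪v, Ψ (star a * b) w⟫_ℂ) ∧
      (Submodule.span ℂ {η | ∃ a ∈ N, ∃ v, V a v = η}).topologicalClosure = ⊤ := by
  classical
  let K : Matrix N N (H →L[ℂ] H) := Matrix.of fun a b => Ψ (star (a : BH H) * (b : BH H))
  have hherm : K.IsHermitian := by
    ext1 a b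
    exact cp_herm hcp b.2 a.2
  have hK : K.PosSemidef := by
    have htf := (RKHS.posSemidef_tfae (K := K)).out 0 2
    rw [htf]
    refine ⟨hherm, fun vv => ?_⟩
    let e := vv.support.equivFin
    have := hcp vv.support.card (fun i => ((e.symm i : vv.support) : N))
      (fun i => ((e.symm i : vv.support) : N).2) (fun i => vv (e.symm i : vv.support))
    have h2 : vv.sum (fun x w => vv.sum fun x' w' => ⟪K x' x w, w'⟫_ℂ) =
        starRingEnd ℂ (∑ i, ∑ j, ⟪vv (e.symm i : vv.support), Ψ (star (((e.symm i : vv.support) : N) : BH H) *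
          (((e.symm j : vv.support) : N) : BH H)) (vv (e.symm j : vv.support))⟫_ℂ) := by
      rw [Finset.sum_comm, map_sum, Finsupp.sum, ← Finset.sum_coe_sort, ← e.symm.sum_comp]
      refine Finset.sum_congr rfl fun i _ => ?_
      rw [map_sum, Finsupp.sum, ← Finset.sum_coe_sort, ← e.symm.sum_comp]
      refine Finset.sum_congr rfl fun j _ => ?_
      rw [inner_conj_symm]
      rfl
    rw [h2]
    have := (Complex.nonneg_iff.1 this).1
    rw [RCLike.conj_re]
    exact this
  haveI : Fact K.PosSemidef := ⟨hK⟩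
  refine ⟨RKHS.OfKernel K, inferInstance, inferInstance, inferInstance,
    fun a => if h : a ∈ N then RKHS.kerFun (RKHS.OfKernel K) (⟨a, h⟩ : N) else 0, ?_, ?_⟩
  · intro a ha b hb v w
    simp only [dif_pos ha, dif_pos hb]
    rw [← RKHS.kernel_inner, RKHS.OfKernel.kernel_ofKernel]
    have := cp_herm hcp ha hb
    change ⟪Ψ (star b * a) v, w⟫_ℂ = _
    rw [← this, star_inner]
  · rw [← RKHS.kerFun_dense (𝕜 := ℂ) (H := RKHS.OfKernel K) (X := N) (V := H)]
    congr 2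
    ext η
    constructor
    · rintro ⟨a, ha, v, rfl⟩
      exact ⟨⟨a, ha⟩, v, by simp only [dif_pos ha]⟩
    · rintro ⟨⟨a, ha⟩, v, rfl⟩
      exact ⟨a, ha, v, by simp only [dif_pos ha]⟩


end

section

structure Dil {L : Type*} [NormedAddCommGroup L] [InnerProductSpace ℂ L] [CompleteSpace L]
    (N A : Set (BH H)) (Ψ : BH H → BH H) (pA : BH H) (V : BH H → H →L[ℂ] L) : Prop where
  alg : Alg N
  hA : IsVNSubalgebra A pA
  hAN : A ⊆ N
  hΨ : IsBimodCP N A Ψ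
  inn : ∀ a ∈ N, ∀ b ∈ N, ∀ v w, ⟪V a v, V b w⟫_ℂ = ⟪v, Ψ (star a * b) w⟫_ℂ
  dense : (Submodule.span ℂ {η | ∃ a ∈ N, ∃ v, V a v = η}).topologicalClosure = ⊤

theorem alg_centralizer {A : Set (BH H)} (h : ∀ x ∈ A, star x ∈ A) : Alg (Set.centralizer A) where
  one := Set.one_mem_centralizer
  add := fun x hx y hy => Set.add_mem_centralizer hx hy
  mul := fun x hx y hy => Set.mul_mem_centralizer hx hy
  smul := fun c x hx m hm => by rw [mul_smul_comm, smul_mul_assoc, hx m hm]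
  stm := fun x hx m hm => by
    have := congrArg star (hx _ (h m hm))
    simpa using this.symm
  sqrt := fun x hx m hm => (commute_sqrt (hx m hm).symm).symm

/-- the Stinespring representation -/
def piOp {L : Type*} [NormedAddCommGroup L] [InnerProductSpace ℂ L]
    (N : Set (BH H)) (V : BH H → H →L[ℂ] L) (a : BH H) : L →L[ℂ] L := by
  classical exact if h : ∃ T : L →L[ℂ] L, ∀ x ∈ N, ∀ v, T (V x v) = V (a * x) v then h.choose else 0

namespace Dil
variable {L : Type*} [NormedAddCommGroup L] [InnerProductSpace ℂ L] [CompleteSpace L]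
  {N A : Set (BH H)} {Ψ : BH H → BH H} {pA : BH H} {V : BH H → H →L[ℂ] L}

theorem ext_gen (h : Dil N A Ψ pA V) {x y : L} (hxy : ∀ a ∈ N, ∀ v, ⟪V a v, x⟫_ℂ = ⟪V a v, y⟫_ℂ) : x = y := by
  have hle : (Submodule.span ℂ {η | ∃ a ∈ N, ∃ v, V a v = η}).topologicalClosure ≤
      (Submodule.span ℂ {x - y})ᗮ := by
    refine Submodule.topologicalClosure_minimal _ ?_ (Submodule.isClosed_orthogonal _)
    rw [Submodule.span_le]
    rintro _ ⟨a, ha, v, rfl⟩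
    rw [SetLike.mem_coe, Submodule.mem_orthogonal_singleton_iff_inner_left, inner_sub_right, hxy a ha v, sub_self]
  rw [h.dense] at hle
  have := hle (Submodule.mem_top (x := x - y))
  rw [Submodule.mem_orthogonal_singleton_iff_inner_left, inner_self_eq_zero, sub_eq_zero] at this
  exact this

theorem ext_op (h : Dil N A Ψ pA V) {S T : L →L[ℂ] L} (hxy : ∀ a ∈ N, ∀ v, S (V a v) = T (V a v)) : S = T := by
  refine ContinuousLinearMap.ext fun x => ext_inner_left ℂ fun w => ?_
  have : star S w = star T w := by
    refine h.ext_gen fun a ha v => ?_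
    rw [inner_star, inner_star, hxy a ha v]
  rw [← star_inner, ← star_inner, this]

theorem V_add (h : Dil N A Ψ pA V) {a b : BH H} (ha : a ∈ N) (hb : b ∈ N) (v : H) : V (a + b) v = V a v + V b v := by
  refine h.ext_gen fun c hc w => ?_
  rw [inner_add_right, h.inn _ hc _ (h.alg.add _ ha _ hb), h.inn _ hc _ ha, h.inn _ hc _ hb, mul_add,
    h.hΨ.map_add _ (h.alg.mul _ (h.alg.stm _ hc) _ ha) _ (h.alg.mul _ (h.alg.stm _ hc) _ hb), _root_.add_apply,
    inner_add_right]

theorem V_smul (h : Dil N A Ψ pA V) (k : ℂ) {a : BH H} (ha : a ∈ N) (v : H) : V (k • a) v = k • V a v := by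
  refine h.ext_gen fun c hc w => ?_
  rw [inner_smul_right, h.inn _ hc _ (h.alg.smul _ _ ha), h.inn _ hc _ ha, mul_smul_comm,
    h.hΨ.map_smul _ _ (h.alg.mul _ (h.alg.stm _ hc) _ ha), _root_.smul_apply, inner_smul_right]

theorem V_sub (h : Dil N A Ψ pA V) {a b : BH H} (ha : a ∈ N) (hb : b ∈ N) (v : H) : V (a - b) v = V a v - V b v := by
  have h1 := h.V_add ha (h.alg.smul (-1) b hb) v
  rw [h.V_smul _ hb] at h1
  simpa [sub_eq_add_neg] using h1

theorem dense_range (h : Dil N A Ψ pA V) :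
    (Submodule.span ℂ (Set.range fun i : N × H => V i.1 i.2)).topologicalClosure = ⊤ := by
  rw [← h.dense]
  congr 2
  ext η
  constructor
  · rintro ⟨⟨⟨a, ha⟩, v⟩, rfl⟩; exact ⟨a, ha, v, rfl⟩
  · rintro ⟨a, ha, v, rfl⟩; exact ⟨⟨⟨a, ha⟩, v⟩, rfl⟩

theorem pi_apply (h : Dil N A Ψ pA V) {a : BH H} (ha : a ∈ N) {x : BH H} (hx : x ∈ N) (v : H) :
    piOp N V a (V x v) = V (a * x) v := by
  have hex : ∃ T : L →L[ℂ] L, ∀ x ∈ N, ∀ v, T (V x v) = V (a * x) v := by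
    obtain ⟨k, hk, hkk⟩ := h.alg.compl ha
    obtain ⟨T, hT⟩ := extLem (fun i : N × H => V i.1 i.2) (fun i : N × H => V (a * i.1) i.2)
      (fun i : N × H => V (k * i.1) i.2) ‖a‖ (norm_nonneg _) h.dense_range (by
        rintro ⟨⟨x, hx⟩, v⟩ ⟨⟨y, hy⟩, w⟩
        simp only
        rw [h.inn _ (h.alg.mul _ ha _ hx) _ (h.alg.mul _ ha _ hy), h.inn _ (h.alg.mul _ hk _ hx) _ (h.alg.mul _ hk _ hy),
          h.inn _ hx _ hy, ← inner_add_right, ← _root_.add_apply,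
          ← h.hΨ.map_add _ (h.alg.mul _ (h.alg.stm _ (h.alg.mul _ ha _ hx)) _ (h.alg.mul _ ha _ hy))
            _ (h.alg.mul _ (h.alg.stm _ (h.alg.mul _ hk _ hx)) _ (h.alg.mul _ hk _ hy)),
          ← inner_smul_right, ← _root_.smul_apply, ← h.hΨ.map_smul _ _ (h.alg.mul _ (h.alg.stm _ hx) _ hy)]
        have e : star (a * x) * (a * y) + star (k * x) * (k * y) = ((‖a‖^2 : ℝ) : ℂ) • (star x * y) := by
          have : star (a * x) * (a * y) + star (k * x) * (k * y) = star x * (star a * a + star k * k) * y := by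
            rw [star_mul, star_mul]; noncomm_ring
          rw [this, hkk]
          rw [mul_smul_comm, smul_mul_assoc, mul_one]
        rw [e])
    exact ⟨T, fun x hx v => hT (⟨x, hx⟩, v)⟩
  unfold piOp
  rw [dif_pos hex]
  exact hex.choose_spec x hx v

theorem pi_star (h : Dil N A Ψ pA V) {a : BH H} (ha : a ∈ N) : star (piOp N V a) = piOp N V (star a) := by
  refine h.ext_op fun x hx v => h.ext_gen fun y hy w => ?_
  rw [inner_star, h.pi_apply ha hy, h.pi_apply (h.alg.stm _ ha) hx, h.inn _ (h.alg.mul _ ha _ hy) _ hx,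
    h.inn _ hy _ (h.alg.mul _ (h.alg.stm _ ha) _ hx), star_mul, mul_assoc]

theorem pi_mul (h : Dil N A Ψ pA V) {a b : BH H} (ha : a ∈ N) (hb : b ∈ N) :
    piOp N V (a * b) = piOp N V a * piOp N V b := by
  refine h.ext_op fun x hx v => ?_
  rw [mul_apply_eq_comp, h.pi_apply hb hx, h.pi_apply ha (h.alg.mul _ hb _ hx), h.pi_apply (h.alg.mul _ ha _ hb) hx, mul_assoc]

theorem pi_sub (h : Dil N A Ψ pA V) {a b : BH H} (ha : a ∈ N) (hb : b ∈ N) :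
    piOp N V (a - b) = piOp N V a - piOp N V b := by
  refine h.ext_op fun x hx v => ?_
  rw [_root_.sub_apply, h.pi_apply hb hx, h.pi_apply ha hx, h.pi_apply (h.alg.sub ha hb) hx, sub_mul,
    h.V_sub (h.alg.mul _ ha _ hx) (h.alg.mul _ hb _ hx)]

theorem pi_nonneg (h : Dil N A Ψ pA V) {a : BH H} (ha : a ∈ N) (h0 : 0 ≤ a) : 0 ≤ piOp N V a := by
  rw [← CFC.sqrt_mul_sqrt_self a h0, h.pi_mul (h.alg.sqrt _ ha) (h.alg.sqrt _ ha)]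
  conv_rhs => enter [1]; rw [← sqrt_sa]
  rw [← h.pi_star (h.alg.sqrt _ ha)]
  exact star_mul_self_nonneg _

theorem exists_rho (h : Dil N A Ψ pA V) {c : BH H} (hc : c ∈ Set.centralizer A) :
    ∃ T : L →L[ℂ] L, (∀ x ∈ N, ∀ v, T (V x v) = V x (c v)) ∧ (∀ x ∈ N, ∀ v, star T (V x v) = V x (star c v)) := by
  have hal := alg_centralizer h.hA.star_mem
  have key : ∀ c ∈ Set.centralizer A, ∀ x ∈ N, ∀ y ∈ N, ∀ v w, ⟪V x (c v), V y w⟫_ℂ = ⟪V x v, V y (star c w)⟫_ℂ := by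
    intro c hc x hx y hy v w
    have hm := h.hΨ.maps_to _ (h.alg.mul _ (h.alg.stm _ hx) _ hy)
    rw [h.inn _ hx _ hy, h.inn _ hx _ hy, ← mul_apply_eq_comp (f := Ψ (star x * y)), hal.stm _ hc _ hm,
      mul_apply_eq_comp, inner_star]
  obtain ⟨k, hk, hkk⟩ := hal.compl hc
  obtain ⟨T, hT⟩ := extLem (fun i : N × H => V i.1 i.2) (fun i : N × H => V i.1 (c i.2))
      (fun i : N × H => V i.1 (k i.2)) ‖c‖ (norm_nonneg _) h.dense_range (by
        rintro ⟨⟨x, hx⟩, v⟩ ⟨⟨y, hy⟩, w⟩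
        simp only
        rw [key c hc x hx y hy, key k hk x hx y hy, ← inner_add_right, ← map_add, ← mul_apply_eq_comp,
          ← mul_apply_eq_comp, ← _root_.add_apply, hkk, _root_.smul_apply, one_apply_eq_self, map_smul, inner_smul_right])
  have hT' : ∀ x ∈ N, ∀ v, T (V x v) = V x (c v) := fun x hx v => hT (⟨x, hx⟩, v)
  refine ⟨T, hT', fun x hx v => h.ext_gen fun y hy w => ?_⟩
  rw [inner_star, hT' y hy, key c hc y hy x hx]

theorem Psi_cut (h : Dil N A Ψ pA V) {S b : BH H} (hS : S ∈ N) (hb : b ∈ A) : Ψ (S * b) = Ψ S * b := by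
  have hSb := h.alg.mul _ hS _ (h.hAN hb)
  have hpA := h.hA.unit_mem
  have h1 : Ψ (pA * (S * b) * pA) = Ψ (S * b) := by
    rw [h.hΨ.bimod _ hpA _ hpA _ hSb, h.hA.unit_left _ (h.hΨ.maps_to _ hSb), h.hA.unit_right _ (h.hΨ.maps_to _ hSb)]
  have h2 : pA * (S * b) * pA = pA * S * b := by
    rw [mul_assoc pA, mul_assoc S, h.hA.unit_right _ hb, mul_assoc]
  rw [← h1, h2, h.hΨ.bimod _ hpA _ hb _ hS, h.hA.unit_left _ (h.hΨ.maps_to _ hS)]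

theorem V_right (h : Dil N A Ψ pA V) {x b : BH H} (hx : x ∈ N) (hb : b ∈ A) (v : H) : V (x * b) v = V x (b v) := by
  refine h.ext_gen fun c hc w => ?_
  rw [h.inn _ hc _ (h.alg.mul _ hx _ (h.hAN hb)), h.inn _ hc _ hx, ← mul_assoc,
    h.Psi_cut (h.alg.mul _ (h.alg.stm _ hc) _ hx) hb, mul_apply_eq_comp]

theorem V_pA (h : Dil N A Ψ pA V) {x : BH H} (hx : x ∈ N) (v : H) : V x (pA v) = V x v := by
  refine h.ext_gen fun c hc w => ?_
  have hm := h.alg.mul _ (h.alg.stm _ hc) _ hx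
  rw [h.inn _ hc _ hx, h.inn _ hc _ hx, ← mul_apply_eq_comp, h.hA.unit_right _ (h.hΨ.maps_to _ hm)]

end Dil


end

section

/-- closed span of the vectors indexed by `W` -/
abbrev QQ {L : Type*} [NormedAddCommGroup L] [InnerProductSpace ℂ L]
    (V : BH H → H →L[ℂ] L) (W : Set (BH H)) : Submodule ℂ L :=
  (Submodule.span ℂ {η | ∃ a ∈ W, ∃ v, V a v = η}).topologicalClosure

/-- the projection onto `QQ` -/
def PP {L : Type*} [NormedAddCommGroup L] [InnerProductSpace ℂ L] [CompleteSpace L]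
    (V : BH H → H →L[ℂ] L) (W : Set (BH H)) : L →L[ℂ] L := (QQ V W).starProjection

/-- the normal part -/
def Phi {L : Type*} [NormedAddCommGroup L] [InnerProductSpace ℂ L] [CompleteSpace L]
    (N : Set (BH H)) (V : BH H → H →L[ℂ] L) (W : Set (BH H)) (T : BH H) : BH H := by
  classical exact if T ∈ N then (ContinuousLinearMap.adjoint (V 1)) ∘L PP V W ∘L V T else 0

namespace Dil
variable {L : Type*} [NormedAddCommGroup L] [InnerProductSpace ℂ L] [CompleteSpace L]
  {N A : Set (BH H)} {Ψ : BH H → BH H} {pA : BH H} {V : BH H → H →L[ℂ] L} {W : Set (BH H)}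

theorem PP_star (V : BH H → H →L[ℂ] L) (W : Set (BH H)) : star (PP V W) = PP V W :=
  isSelfAdjoint_starProjection (QQ V W)

theorem PP_idem (V : BH H → H →L[ℂ] L) (W : Set (BH H)) (v : L) : PP V W (PP V W v) = PP V W v :=
  Submodule.starProjection_eq_self_iff.2 (Submodule.starProjection_apply_mem _ _)

theorem PP_mem (V : BH H → H →L[ℂ] L) (W : Set (BH H)) (v : L) : PP V W v ∈ QQ V W :=
  Submodule.starProjection_apply_mem _ _

theorem PP_gen (V : BH H → H →L[ℂ] L) {W : Set (BH H)} {a : BH H} (ha : a ∈ W) (v : H) : PP V W (V a v) = V a v :=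
  Submodule.starProjection_eq_self_iff.2 (Submodule.le_topologicalClosure _ (Submodule.subset_span ⟨a, ha, v, rfl⟩))

theorem gen_mem (V : BH H → H →L[ℂ] L) {W : Set (BH H)} {a : BH H} (ha : a ∈ W) (v : H) : V a v ∈ QQ V W :=
  Submodule.le_topologicalClosure _ (Submodule.subset_span ⟨a, ha, v, rfl⟩)

theorem PP_pi (h : Dil N A Ψ pA V) (hW : W ⊆ N) (hNW : ∀ a ∈ N, ∀ x ∈ W, a * x ∈ W) {a : BH H} (ha : a ∈ N) (v : L) :
    PP V W (piOp N V a v) = piOp N V a (PP V W v) := by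
  refine comm_proj _ _ _ rfl ?_ ?_ v
  · rintro _ ⟨x, hx, v, rfl⟩
    rw [h.pi_apply ha (hW hx)]
    exact gen_mem V (hNW _ ha _ hx) _
  · rintro _ ⟨x, hx, v, rfl⟩
    rw [h.pi_star ha, h.pi_apply (h.alg.stm _ ha) (hW hx)]
    exact gen_mem V (hNW _ (h.alg.stm _ ha) _ hx) _

theorem Phi_inner1 (h : Dil N A Ψ pA V) {T : BH H} (hT : T ∈ N) (v w : H) :
    ⟪v, Phi N V W T w⟫_ℂ = ⟪V 1 v, PP V W (V T w)⟫_ℂ := by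
  unfold Phi
  rw [if_pos hT, ContinuousLinearMap.comp_apply, ContinuousLinearMap.adjoint_inner_right]
  rfl

theorem Phi_inner (h : Dil N A Ψ pA V) (hW : W ⊆ N) (hNW : ∀ a ∈ N, ∀ x ∈ W, a * x ∈ W) {a b : BH H}
    (ha : a ∈ N) (hb : b ∈ N) (v w : H) :
    ⟪v, Phi N V W (star a * b) w⟫_ℂ = ⟪V a v, PP V W (V b w)⟫_ℂ := by
  rw [h.Phi_inner1 (h.alg.mul _ (h.alg.stm _ ha) _ hb), ← h.pi_apply (h.alg.stm _ ha) hb,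
    h.PP_pi hW hNW (h.alg.stm _ ha), ← h.pi_star ha, inner_star, h.pi_apply ha h.alg.one, mul_one]

theorem Phi_quad (h : Dil N A Ψ pA V) (hW : W ⊆ N) (hNW : ∀ a ∈ N, ∀ x ∈ W, a * x ∈ W) {T : BH H}
    (hT : T ∈ N) (v : H) :
    ⟪v, Phi N V W T v⟫_ℂ = ⟪PP V W (V 1 v), piOp N V T (PP V W (V 1 v))⟫_ℂ := by
  rw [h.Phi_inner1 hT, ← PP_idem, ← sa_inner (PP_star V W)]
  conv_lhs => rw [← mul_one T, ← h.pi_apply hT h.alg.one, h.PP_pi hW hNW hT]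

theorem ext_inn {S T : BH H} (h : ∀ v w, ⟪v, S w⟫_ℂ = ⟪v, T w⟫_ℂ) : S = T :=
  ContinuousLinearMap.ext fun w => ext_inner_left ℂ fun v => h v w

theorem Phi_bimod (h : Dil N A Ψ pA V) (hW : W ⊆ N) (hNW : ∀ a ∈ N, ∀ x ∈ W, a * x ∈ W) :
    IsBimodCP N A (Phi N V W) where
  map_add := fun T hT S hS => ext_inn fun v w => by
    rw [_root_.add_apply, inner_add_right, h.Phi_inner1 hT, h.Phi_inner1 hS, h.Phi_inner1 (h.alg.add _ hT _ hS),
      h.V_add hT hS, map_add, inner_add_right]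
  map_smul := fun c T hT => ext_inn fun v w => by
    rw [_root_.smul_apply, inner_smul_right, h.Phi_inner1 hT, h.Phi_inner1 (h.alg.smul _ _ hT),
      h.V_smul _ hT, map_smul, inner_smul_right]
  cp := fun n a ha v => by
    have : ∑ i : Fin n, ∑ j : Fin n, ⟪v i, (Phi N V W (star (a i) * a j)) (v j)⟫_ℂ
        = ⟪∑ i, PP V W (V (a i) (v i)), ∑ i, PP V W (V (a i) (v i))⟫_ℂ := by
      rw [sum_inner]
      refine Finset.sum_congr rfl fun i _ => ?_
      rw [inner_sum]
      refine Finset.sum_congr rfl fun j _ => ?_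
      rw [h.Phi_inner hW hNW (ha i) (ha j), sa_inner (PP_star V W), PP_idem]
    rw [this, inner_self_c]
    exact Complex.zero_le_real.2 (sq_nonneg _)
  bimod := fun a ha b hb T hT => ext_inn fun v w => by
    have hsa := h.hA.star_mem _ ha
    have hTb := h.alg.mul _ hT _ (h.hAN hb)
    have e : a * T * b = star (star a) * (T * b) := by rw [star_star, mul_assoc]
    rw [e, h.Phi_inner hW hNW (h.hAN hsa) hTb, h.V_right hT hb, ← one_mul (star a), h.V_right h.alg.one hsa,
      ← h.Phi_inner1 hT, star_inner, ← mul_apply_eq_comp, ← mul_apply_eq_comp]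
  maps_to := fun T hT => by
    have h1 : Phi N V W T ∈ Set.centralizer (Set.centralizer A) := by
      intro c hc
      obtain ⟨R, hR, hR'⟩ := h.exists_rho hc
      refine ext_inn fun v w => ?_
      have hc1 : ∀ x, PP V W (R x) = R (PP V W x) := by
        intro x
        refine comm_proj _ _ _ rfl ?_ ?_ x
        · rintro _ ⟨x, hx, v, rfl⟩
          rw [hR _ (hW hx)]
          exact gen_mem V hx _
        · rintro _ ⟨x, hx, v, rfl⟩
          rw [hR' _ (hW hx)]
          exact gen_mem V hx _
      rw [mul_apply_eq_comp, mul_apply_eq_comp, h.Phi_inner1 hT, ← hR _ hT, hc1, ← star_inner R, hR' _ h.alg.one,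
        ← h.Phi_inner1 hT, star_inner]
    have h2 := h.hA.weakly_closed _ h1
    have h3 : pA * Phi N V W T * pA = Phi N V W T := by
      refine ext_inn fun v w => ?_
      have hsa : star pA = pA := h.hA.unit_proj.1
      rw [mul_apply_eq_comp, mul_apply_eq_comp, ← sa_inner hsa, h.Phi_inner1 hT, h.Phi_inner1 hT, h.V_pA hT, h.V_pA h.alg.one]
    rwa [h3] at h2

end Dil


end

section

open Filter in
theorem lub_of_tendsto {ι : Type*} [Preorder ι] [IsDirectedOrder ι] [Nonempty ι] (G : ι → BH H) (X : BH H)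
    (hG : ∀ i, G i ≤ X) (ht : ∀ v, Tendsto (fun i => (⟪v, (X - G i) v⟫_ℂ).re) atTop (nhds 0)) :
    IsLUB (Set.range G) X := by
  refine ⟨by rintro _ ⟨i, rfl⟩; exact hG i, fun u hu => ?_⟩
  rw [← sub_nonneg, nonneg_iff_inner]
  intro v
  have e : ∀ i, ⟪v, (u - X) v⟫_ℂ = ⟪v, (u - G i) v⟫_ℂ - ⟪v, (X - G i) v⟫_ℂ := by
    intro i
    rw [← inner_sub_right, ← _root_.sub_apply]
    congr 2
    abel
  have h1 : ∀ i, 0 ≤ ⟪v, (u - G i) v⟫_ℂ := fun i =>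
    (nonneg_iff_inner _).1 (sub_nonneg.2 (hu ⟨i, rfl⟩)) v
  have h2 : ∀ i, 0 ≤ ⟪v, (X - G i) v⟫_ℂ := fun i =>
    (nonneg_iff_inner _).1 (sub_nonneg.2 (hG i)) v
  rw [Complex.nonneg_iff]
  constructor
  · have h3 : Tendsto (fun i => -(⟪v, (X - G i) v⟫_ℂ).re) atTop (nhds 0) := by
      simpa using (ht v).neg
    refine le_of_tendsto' h3 fun i => ?_
    have := (Complex.nonneg_iff.1 (h1 i)).1
    rw [e i, Complex.sub_re]; linarith
  · obtain ⟨i⟩ := (inferInstance : Nonempty ι)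
    rw [e i, Complex.sub_im, ← (Complex.nonneg_iff.1 (h1 i)).2, ← (Complex.nonneg_iff.1 (h2 i)).2]; simp

theorem conj_nonneg {b : BH H} (hb : 0 ≤ b) (z : BH H) : 0 ≤ star z * b * z := by
  rw [nonneg_iff_inner] at hb ⊢
  intro v
  rw [mul_apply_eq_comp, mul_apply_eq_comp, inner_star]
  exact hb _

theorem Psi_nonneg {N A : Set (BH H)} (hN : Alg N) {Ψ : BH H → BH H} (hΨ : IsBimodCP N A Ψ) {x : BH H} (hx : x ∈ N)
    (h0 : 0 ≤ x) : 0 ≤ Ψ x := by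
  rw [nonneg_iff_inner]
  intro v
  have := cp_one hΨ.cp (hN.sqrt _ hx) v
  rwa [sqrt_sa, CFC.sqrt_mul_sqrt_self _ h0] at this

theorem Psi_sub {N A : Set (BH H)} (hN : Alg N) {Ψ : BH H → BH H} (hΨ : IsBimodCP N A Ψ) {x y : BH H} (hx : x ∈ N)
    (hy : y ∈ N) : Ψ (x - y) = Ψ x - Ψ y := by
  have := hΨ.map_add _ (hN.sub hx hy) _ hy
  rw [sub_add_cancel] at this
  rw [this]; abel

theorem Psi_mono {N A : Set (BH H)} (hN : Alg N) {Ψ : BH H → BH H} (hΨ : IsBimodCP N A Ψ) {x y : BH H} (hx : x ∈ N)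
    (hy : y ∈ N) (hxy : x ≤ y) : Ψ x ≤ Ψ y := by
  rw [← sub_nonneg, ← Psi_sub hN hΨ hy hx]
  exact Psi_nonneg hN hΨ (hN.sub hy hx) (sub_nonneg.2 hxy)

namespace Ctx
variable {M : VonNeumannAlgebra H} {J : H ≃ₗᵢ⋆[ℂ] H} {Bt : Set (BH H)} {E : BH H → BH H}
    {ξ : H} {p : BH H}

theorem algN (h : Ctx M J Bt E ξ p) : Alg (basicConstruction J Bt) where
  one := one_N
  add := fun _ hx _ hy => add_N hx hy
  mul := fun _ hx _ hy => mul_N hx hy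
  smul := fun c _ hx => smul_N c hx
  stm := fun _ hx => h.star_N hx
  sqrt := fun _ hx => sqrt_N hx

theorem Bt_sub (h : Ctx M J Bt E ξ p) {a b : BH H} (ha : a ∈ Bt) (hb : b ∈ Bt) : a - b ∈ Bt := by
  have hbM : ((-1 : ℂ) • b) ∈ (M : Set (BH H)) := M.toStarSubalgebra.smul_mem (h.ce.subset hb) (-1)
  have h1 := h.ce.map_add a (h.ce.subset ha) _ hbM
  rw [h.ce.map_smul _ _ (h.ce.subset hb), h.ce.fixes _ ha, h.ce.fixes _ hb] at h1
  have h2 := h.ce.maps_to _ (add_mem (h.ce.subset ha) hbM)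
  rw [h1] at h2
  simpa [sub_eq_add_neg] using h2

theorem span_dense' (h : Ctx M J Bt E ξ p) :
    (Submodule.span ℂ {η : H | ∃ x ∈ (M : Set (BH H)), conjJ J x ξ = η}).topologicalClosure = ⊤ := by
  rw [← Submodule.dense_iff_topologicalClosure_eq_top]
  exact h.dense'.mono Submodule.subset_span

open Filter in
theorem bnet (h : Ctx M J Bt E ξ p) {ι : Type*} [Preorder ι] [IsDirectedOrder ι] [Nonempty ι] (F : ι → BH H)
    (hF : Antitone F) (h0 : ∀ i, 0 ≤ F i) (hN : ∀ i, F i ∈ basicConstruction J Bt)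
    (ht : ∀ v, Tendsto (fun i => (⟪v, F i v⟫_ℂ).re) atTop (nhds 0))
    {y : BH H} (hy : y ∈ basicConstruction J Bt) :
    ∃ b : ι → BH H, (∀ i, b i ∈ Bt) ∧ (∀ i, b i * p = star (y * p) * F i * (y * p)) ∧ Antitone b ∧ (∀ i, 0 ≤ b i) ∧
      ∀ v, Tendsto (fun i => (⟪v, b i v⟫_ℂ).re) atTop (nhds 0) := by
  have hyp : y * p ∈ basicConstruction J Bt := mul_N hy h.p_mem
  have hex : ∀ i, ∃ b ∈ Bt, b * p = star (y * p) * F i * (y * p) := fun i => by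
    refine h.lemB (mul_N (mul_N (h.star_N hyp) (hN i)) hyp) ?_
    have e1 : y * p * p = y * p := by rw [mul_assoc, h.pp]
    have e2 : p * star (y * p) = star (y * p) := by
      have := congrArg star e1
      rwa [star_mul, h.psa] at this
    calc p * (star (y * p) * F i * (y * p)) * p = (p * star (y * p)) * F i * (y * p * p) := by noncomm_ring
      _ = _ := by rw [e1, e2]
  choose b hb hbp using hex
  have hb0 : ∀ i, 0 ≤ b i := fun i => h.lemC_pos (hb i) (by rw [hbp]; exact conj_nonneg (h0 i) _)
  have han : Antitone b := fun i j hij => by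
    rw [← sub_nonneg]
    refine h.lemC_pos (h.Bt_sub (hb i) (hb j)) ?_
    have : (b i - b j) * p = star (y * p) * (F i - F j) * (y * p) := by
      rw [sub_mul, hbp, hbp, mul_sub, sub_mul]
    rw [this]
    exact conj_nonneg (sub_nonneg.2 (hF hij)) _
  refine ⟨b, hb, hbp, han, hb0, fun v => ?_⟩
  refine null_closed b han hb0 {η : H | ∃ x ∈ (M : Set (BH H)), conjJ J x ξ = η} ?_ v
    (by rw [h.span_dense']; trivial)
  rintro _ ⟨x, hx, rfl⟩
  obtain ⟨r, hr⟩ := h.lemC hx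
  have : (fun i => (⟪conjJ J x ξ, b i (conjJ J x ξ)⟫_ℂ).re) =
      fun i => (⟪(y * p) (r ξ), F i ((y * p) (r ξ))⟫_ℂ).re := by
    funext i
    rw [hr _ (hb i), hbp, mul_apply_eq_comp, mul_apply_eq_comp, inner_star]
  rw [this]
  exact ht _

/-- generators -/
def WW (M : VonNeumannAlgebra H) (J : H ≃ₗᵢ⋆[ℂ] H) (Bt : Set (BH H)) (p : BH H) : Set (BH H) :=
  {T | ∃ y ∈ basicConstruction J Bt, ∃ z ∈ (M : Set (BH H)), y * p * z = T}

theorem WW_sub (h : Ctx M J Bt E ξ p) : WW M J Bt p ⊆ basicConstruction J Bt := by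
  rintro _ ⟨y, hy, z, hz, rfl⟩
  exact mul_N (mul_N hy h.p_mem) (h.M_sub_N hz)

theorem WW_mul (h : Ctx M J Bt E ξ p) : ∀ a ∈ basicConstruction J Bt, ∀ x ∈ WW M J Bt p, a * x ∈ WW M J Bt p := by
  rintro a ha _ ⟨y, hy, z, hz, rfl⟩
  exact ⟨a * y, mul_N ha hy, z, hz, by noncomm_ring⟩

open Filter in
theorem genlim (h : Ctx M J Bt E ξ p) {A : Set (BH H)} {Ψ : BH H → BH H}
    (hΨ : IsBimodCP (basicConstruction J Bt) A Ψ) (hn : IsNormalOn (M : Set (BH H)) Ψ)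
    {ι : Type*} [Preorder ι] [IsDirectedOrder ι] [Nonempty ι] (F : ι → BH H)
    (hF : Antitone F) (h0 : ∀ i, 0 ≤ F i) (hN : ∀ i, F i ∈ basicConstruction J Bt)
    (ht : ∀ v, Tendsto (fun i => (⟪v, F i v⟫_ℂ).re) atTop (nhds 0))
    {x : BH H} (hx : x ∈ WW M J Bt p) (ζ : H) :
    Tendsto (fun i => (⟪ζ, Ψ (star x * (F i * x)) ζ⟫_ℂ).re) atTop (nhds 0) := by
  obtain ⟨y, hy, z, hz, rfl⟩ := hx
  obtain ⟨b, hb, hbp, han, hb0, hbt⟩ := h.bnet F hF h0 hN ht hy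
  have hbM : ∀ i, b i ∈ (M : Set (BH H)) := fun i => h.ce.subset (hb i)
  have hGM : ∀ i, star z * b i * z ∈ (M : Set (BH H)) := fun i => mul_mem (mul_mem (star_mem hz) (hbM i)) hz
  have hGM' : ∀ i, -(star z * b i * z) ∈ (M : Set (BH H)) := fun i => by
    have := M.toStarSubalgebra.smul_mem (hGM i) (-1)
    simpa using this
  have h0M : (0 : BH H) ∈ (M : Set (BH H)) := zero_mem M.toStarSubalgebra
  have hmon : Monotone fun i => -(star z * b i * z) := fun i j hij => by
    rw [← sub_nonneg]
    have : -(star z * b j * z) - -(star z * b i * z) = star z * (b i - b j) * z := by noncomm_ring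
    rw [this]
    exact conj_nonneg (sub_nonneg.2 (han hij)) z
  have hlub : IsLUB (Set.range fun i => -(star z * b i * z)) 0 := by
    refine lub_of_tendsto _ _ (fun i => neg_nonpos.2 (conj_nonneg (hb0 i) z)) fun v => ?_
    have : (fun i => (⟪v, ((0 : BH H) - -(star z * b i * z)) v⟫_ℂ).re) = fun i => (⟪z v, b i (z v)⟫_ℂ).re := by
      funext i
      rw [zero_sub, neg_neg, mul_apply_eq_comp, mul_apply_eq_comp, inner_star]
    rw [this]
    exact hbt _
  have h2 := hn _ (by rintro _ ⟨i, rfl⟩; exact hGM' i) (Set.range_nonempty _)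
    (directedOn_range.2 hmon.directed_le) 0 h0M hlub
  rw [← Set.range_comp] at h2
  have h3 := vigier _ (fun i j hij => Psi_mono h.algN hΨ (h.M_sub_N (hGM' i)) (h.M_sub_N (hGM' j)) (hmon hij)) _ h2 ζ
  have e3 : ∀ i, Ψ 0 - (Ψ ∘ fun i => -(star z * b i * z)) i = Ψ (star z * b i * z) := fun i => by
    have := Psi_sub h.algN hΨ (h.M_sub_N h0M) (h.M_sub_N (hGM' i))
    rw [Function.comp_apply, ← this, zero_sub, neg_neg]
  replace h3 : Tendsto (fun i => (⟪ζ, Ψ (star z * b i * z) ζ⟫_ℂ).re) atTop (nhds 0) :=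
    h3.congr fun i => by rw [← e3 i]; rfl
  have hxN := h.WW_sub ⟨y, hy, z, hz, rfl⟩
  have hxF : ∀ i, star (y * p * z) * (F i * (y * p * z)) ∈ basicConstruction J Bt := fun i =>
    mul_N (h.star_N hxN) (mul_N (hN i) hxN)
  refine squeeze_zero (fun i => ?_) (fun i => ?_) h3
  · refine (Complex.nonneg_iff.1 ((nonneg_iff_inner _).1 (Psi_nonneg h.algN hΨ (hxF i) ?_) ζ)).1
    rw [← mul_assoc]; exact conj_nonneg (h0 i) _
  · have hle : star (y * p * z) * (F i * (y * p * z)) ≤ star z * b i * z := by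
      rw [← sub_nonneg]
      have e1 : star (y * p * z) * (F i * (y * p * z)) = star z * (b i * p) * z := by
        rw [hbp, star_mul (y * p) z]; noncomm_ring
      have hs : star (1 - p) = 1 - p := by rw [star_sub, star_one, h.psa]
      have e2 : star z * b i * z - star z * (b i * p) * z = star z * (star (1 - p) * b i * (1 - p)) * z := by
        rw [hs]
        have e4 : (1 - p) * b i * (1 - p) = b i - b i * p := by
          have := h.p_comm (hb i)
          calc (1 - p) * b i * (1 - p) = b i - p * b i - b i * p + (p * b i) * p := by noncomm_ring
            _ = b i - b i * p := by rw [this, mul_assoc, h.pp]; abel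
        rw [e4]; noncomm_ring
      rw [e1, e2]
      exact conj_nonneg (conj_nonneg (hb0 i) _) _
    have := Psi_mono h.algN hΨ (hxF i) (h.M_sub_N (hGM i)) hle
    have := (Complex.nonneg_iff.1 ((nonneg_iff_inner _).1 (sub_nonneg.2 this) ζ)).1
    rw [_root_.sub_apply, inner_sub_right, Complex.sub_re] at this
    linarith

open Filter in
theorem Phi_normal (h : Ctx M J Bt E ξ p) {L : Type*} [NormedAddCommGroup L] [InnerProductSpace ℂ L] [CompleteSpace L]
    {A : Set (BH H)} {Ψ : BH H → BH H} {pA : BH H} {V : BH H → H →L[ℂ] L}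
    (d : Dil (basicConstruction J Bt) A Ψ pA V) (hn : IsNormalOn (M : Set (BH H)) Ψ) :
    IsNormalOn (basicConstruction J Bt) (Phi (basicConstruction J Bt) V (WW M J Bt p)) := by
  intro S hS hne hdir x hx hlub
  have hbc := d.Phi_bimod h.WW_sub h.WW_mul
  haveI : Nonempty S := hne.to_subtype
  haveI : IsDirectedOrder S := ⟨fun a b => by
    obtain ⟨c, hc, h1, h2⟩ := hdir a a.2 b b.2
    exact ⟨⟨c, hc⟩, h1, h2⟩⟩
  have hlub' : IsLUB (Set.range (fun s : S => (s : BH H))) x := by rwa [Subtype.range_coe]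
  have hv := vigier (fun s : S => (s : BH H)) (fun a b hab => hab) x hlub'
  have hsN : ∀ s : S, x - (s : BH H) ∈ basicConstruction J Bt := fun s => sub_N hx (hS s.2)
  have hs0 : ∀ s : S, 0 ≤ x - (s : BH H) := fun s => sub_nonneg.2 (hlub.1 s.2)
  have hanti : Antitone fun s : S => x - (s : BH H) := fun a b hab => sub_le_sub_left (show (a : BH H) ≤ b from hab) x
  have key := null_closed (fun s : S => piOp (basicConstruction J Bt) V (x - (s : BH H)))
    (fun a b hab => by
      rw [← sub_nonneg, ← d.pi_sub (hsN a) (hsN b)]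
      exact d.pi_nonneg (sub_N (hsN a) (hsN b)) (sub_nonneg.2 (hanti hab)))
    (fun s => d.pi_nonneg (hsN s) (hs0 s)) {η | ∃ a ∈ WW M J Bt p, ∃ v, V a v = η} (by
      rintro _ ⟨a, ha, ζ, rfl⟩
      have := h.genlim d.hΨ hn (fun s : S => x - (s : BH H)) hanti hs0 hsN hv ha ζ
      refine this.congr fun s => ?_
      rw [d.pi_apply (hsN s) (h.WW_sub ha), d.inn _ (h.WW_sub ha) _ (mul_N (hsN s) (h.WW_sub ha))])
  have e : Phi (basicConstruction J Bt) V (WW M J Bt p) '' S =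
      Set.range (fun s : S => Phi (basicConstruction J Bt) V (WW M J Bt p) s) := by
    rw [Set.image_eq_range]
  rw [e]
  refine lub_of_tendsto _ _ (fun s => Psi_mono h.algN hbc (hS s.2) hx (hlub.1 s.2)) fun v => ?_
  refine (key _ (Dil.PP_mem V (WW M J Bt p) (V 1 v))).congr fun s => ?_
  rw [← Psi_sub h.algN hbc hx (hS s.2), d.Phi_quad h.WW_sub h.WW_mul (hsN s)]

end Ctx

end
section

namespace Ctx
variable {M : VonNeumannAlgebra H} {J : H ≃ₗᵢ⋆[ℂ] H} {Bt : Set (BH H)} {E : BH H → BH H}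
    {ξ : H} {p : BH H}

theorem Phi_nonzero (h : Ctx M J Bt E ξ p) {L : Type*} [NormedAddCommGroup L] [InnerProductSpace ℂ L] [CompleteSpace L]
    {A : Set (BH H)} {Ψ : BH H → BH H} {pA : BH H} {V : BH H → H →L[ℂ] L}
    (d : Dil (basicConstruction J Bt) A Ψ pA V) {f : BH H} (hfN : f ∈ basicConstruction J Bt)
    (hfM : ∀ z ∈ (M : Set (BH H)), z * f = f * z) (hfp : p * f = f * p) (hfs : star f = f) (hff : f * f = f)
    (hpAM : pA ∈ (M : Set (BH H))) {x y : BH H} (hx : x ∈ (M : Set (BH H))) (hy : y ∈ (M : Set (BH H)))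
    (hne : Ψ (pA * (x * (p * f) * y) * pA) ≠ 0) :
    Phi (basicConstruction J Bt) V (WW M J Bt p) (pA * f) ≠ 0 := by
  intro h0
  apply hne
  have hsa : star pA = pA := d.hA.unit_proj.1
  have hpp : pA * pA = pA := d.hA.unit_proj.2
  have hgN : pA * f ∈ basicConstruction J Bt := mul_N (h.M_sub_N hpAM) hfN
  have hgg : star (pA * f) * (pA * f) = pA * f := by
    rw [star_mul, hfs, hsa]
    calc f * pA * (pA * f) = f * (pA * pA) * f := by noncomm_ring
      _ = pA * f := by rw [hpp, ← hfM _ hpAM, mul_assoc, hff]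
  have hP : ∀ v, PP V (WW M J Bt p) (V (pA * f) v) = 0 := by
    intro v
    have h1 := d.Phi_inner h.WW_sub h.WW_mul hgN hgN v v
    rw [hgg, h0, ← Dil.PP_idem, ← sa_inner (Dil.PP_star V (WW M J Bt p))] at h1
    simpa using h1.symm
  have hW : pA * (x * (p * f) * y) * pA ∈ WW M J Bt p :=
    ⟨pA * x * f, mul_N (mul_N (h.M_sub_N hpAM) (h.M_sub_N hx)) hfN, y * pA, mul_mem hy hpAM, by
      rw [hfp]; noncomm_ring⟩
  have hk : pA * x * p * y ∈ basicConstruction J Bt :=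
    mul_N (mul_N (mul_N (h.M_sub_N hpAM) (h.M_sub_N hx)) h.p_mem) (h.M_sub_N hy)
  have e : pA * (x * (p * f) * y) * pA = (pA * x * p * y) * (pA * f) := by
    calc pA * (x * (p * f) * y) * pA = pA * x * p * (f * (y * pA)) := by noncomm_ring
      _ = pA * x * p * ((y * pA) * f) := by rw [hfM (y * pA) (mul_mem hy hpAM)]
      _ = _ := by noncomm_ring
  have hV : ∀ w, V (pA * (x * (p * f) * y) * pA) w = 0 := by
    intro w
    rw [← Dil.PP_gen V hW, e, ← d.pi_apply hk hgN, d.PP_pi h.WW_sub h.WW_mul hk, hP, map_zero]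
  refine Dil.ext_inn fun v w => ?_
  have := d.inn 1 d.alg.one _ (h.WW_sub hW) v w
  rw [star_one, one_mul, hV] at this
  rw [← this]; simp

end Ctx

theorem mk_ctx (M : VonNeumannAlgebra H) (sf : StandardForm M) (Bset : Set (BH H)) (pB : BH H)
    (hB : IsVNSubalgebra Bset pB) (EB : BH H → BH H)
    (hEB : IsCondExp (M : Set (BH H)) (Btilde Bset pB) EB)
    (ξ : H) (hξcone : ξ ∈ sf.cone)
    (hξcyclic : Dense {η : H | ∃ x ∈ (M : Set (BH H)), x ξ = η})
    (hξEB : ∀ x ∈ (M : Set (BH H)), ⟪ξ, (EB x) ξ⟫_ℂ = ⟪ξ, x ξ⟫_ℂ)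
    (eBt : BH H) (heBtproj : IsProjection eBt)
    (heBtrange : ∀ η : H, eBt η ∈ closure {η : H | ∃ b ∈ Btilde Bset pB, b ξ = η})
    (heBtfix : ∀ η ∈ closure {η : H | ∃ b ∈ Btilde Bset pB, b ξ = η}, eBt η = η) :
    Ctx M sf.J (Btilde Bset pB) EB ξ eBt where
  hJ := sf.J_involutive
  hJξ := sf.J_fixes_cone ξ hξcone
  comm := sf.commutant_eq
  dense := hξcyclic
  pos := fun x hx hs => by
    have h1 := sf.cone_invariant x hx ξ hξcone
    rw [conjJ_apply sf.J_involutive, sf.J_fixes_cone ξ hξcone] at h1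
    have h2 : x (sf.J (x ξ)) ∈ {ξ : H | ∀ η ∈ sf.cone, 0 ≤ ⟪ξ, η⟫_ℂ} := sf.selfdual ▸ h1
    have h3 := h2 ξ hξcone
    rw [sa_inner hs, ← inner_conj_symm] at h3
    have := (Complex.nonneg_iff.1 h3).1
    rwa [Complex.conj_re] at this
  one := ⟨pB, hB.unit_mem, 1, by simp⟩
  mul := by
    rintro _ ⟨b, hb, c, rfl⟩ _ ⟨b', hb', c', rfl⟩
    refine ⟨b * b', hB.mul_mem _ hb _ hb', c * c', ?_⟩
    have h1 : b * (1 - pB) = 0 := by rw [mul_sub, mul_one, hB.unit_right _ hb, sub_self]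
    have h2 : (1 - pB) * b' = 0 := by rw [sub_mul, one_mul, hB.unit_left _ hb', sub_self]
    have h3 : (1 - pB) * (1 - pB) = 1 - pB := by
      have : pB * pB = pB := hB.unit_proj.2
      rw [mul_sub, mul_one, sub_mul, one_mul, this]; abel
    rw [add_mul, mul_add, mul_add, mul_smul_comm, smul_mul_assoc, smul_mul_assoc, mul_smul_comm, h1, h2, h3, smul_smul]
    simp
  stm := by
    rintro _ ⟨b, hb, c, rfl⟩
    have : star pB = pB := hB.unit_proj.1
    exact ⟨star b, hB.star_mem _ hb, star c, by rw [star_add, star_smul, star_sub, star_one, this]⟩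
  ce := hEB
  hE := hξEB
  psa := heBtproj.1
  pp := heBtproj.2
  range := heBtrange
  fix := heBtfix


end

/-- **Theorem 2.3 (iv) ⇒ (iii).**  Basic-construction setup: `M` σ-finite with standard form
`L²(M) = H`, `A ⊆ 1_A M 1_A` and `B ⊆ 1_B M 1_B` von Neumann subalgebras with expectation,
`B̃ = B ⊕ ℂ 1_B^⊥`, `E_{B̃} : M → B̃` a faithful normal conditional expectation, `e_{B̃}` the
Jones projection and `⟨M, B̃⟩ = (J B̃ J)'` the basic construction.  If there is an
`A`-`A`-bimodular completely positive map `Ψ : ⟨M, B̃⟩ → A` which is normal on `M` and does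
not vanish on `1_A M e_B M 1_A` (where `e_B = e_{B̃} J 1_B J`), then there is a *normal*
`A`-`A`-bimodular completely positive map `Φ : ⟨M, B̃⟩ → A` with `Φ(1_A J 1_B J) ≠ 0`. -/
theorem normal_bimodular_cp_map_of_bimodular_cp_map
    {H : Type*} [NormedAddCommGroup H] [InnerProductSpace ℂ H] [CompleteSpace H]
    (M : VonNeumannAlgebra H) (hσM : SigmaFinite (M : Set (BH H)))
    (sf : StandardForm M)
    (A Bset : Set (BH H)) (pA pB : BH H)
    (hA : IsVNSubalgebra A pA) (hB : IsVNSubalgebra Bset pB)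
    (hAM : A ⊆ (M : Set (BH H))) (hBM : Bset ⊆ (M : Set (BH H)))
    (hAexp : WithExpectation (Corner pA (M : Set (BH H))) A)
    (hBexp : WithExpectation (Corner pB (M : Set (BH H))) Bset)
    -- the faithful normal conditional expectation `E_{B̃} : M → B̃`
    (EB : BH H → BH H)
    (hEB : IsCondExp (M : Set (BH H)) (Btilde Bset pB) EB)
    (hEBfaithful : FaithfulOn (M : Set (BH H)) EB)
    (hEBnormal : IsNormalOn (M : Set (BH H)) EB)
    -- `ξ` a cyclic and separating vector whose state is preserved by `E_{B̃}`, realizing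
    -- the embedding `L²(B̃) ⊆ L²(M)` as the closure of `B̃ ξ`
    (ξ : H) (hξcone : ξ ∈ sf.cone)
    (hξcyclic : Dense {η : H | ∃ x ∈ (M : Set (BH H)), x ξ = η})
    (hξfaithful : ∀ x ∈ (M : Set (BH H)), 0 ≤ x → ⟪ξ, x ξ⟫_ℂ = 0 → x = 0)
    (hξEB : ∀ x ∈ (M : Set (BH H)), ⟪ξ, (EB x) ξ⟫_ℂ = ⟪ξ, x ξ⟫_ℂ)
    -- the Jones projection `e_{B̃} : L²(M) → L²(B̃)`
    (eBt : BH H) (heBtproj : IsProjection eBt)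
    (heBtrange : ∀ η : H, eBt η ∈ closure {η : H | ∃ b ∈ Btilde Bset pB, b ξ = η})
    (heBtfix : ∀ η ∈ closure {η : H | ∃ b ∈ Btilde Bset pB, b ξ = η}, eBt η = η)
    -- the hypothesis: an `A`-`A`-bimodular cp map `Ψ : ⟨M, B̃⟩ → A`, normal on `M`,
    -- nonzero on `1_A M e_B M 1_A` where `e_B := e_{B̃} J 1_B J`
    (Ψ : BH H → BH H)
    (hΨ : IsBimodCP (basicConstruction sf.J (Btilde Bset pB)) A Ψ)
    (hΨnormalM : IsNormalOn (M : Set (BH H)) Ψ)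
    (hΨnonzero : ∃ x ∈ (M : Set (BH H)), ∃ y ∈ (M : Set (BH H)),
      Ψ (pA * (x * (eBt * conjJ sf.J pB) * y) * pA) ≠ 0) :
    ∃ Φ : BH H → BH H,
      IsBimodCP (basicConstruction sf.J (Btilde Bset pB)) A Φ ∧
      IsNormalOn (basicConstruction sf.J (Btilde Bset pB)) Φ ∧
      Φ (pA * conjJ sf.J pB) ≠ 0 := by
  have h : Ctx M sf.J (Btilde Bset pB) EB ξ eBt :=
    mk_ctx M sf Bset pB hB EB hEB ξ hξcone hξcyclic hξEB eBt heBtproj heBtrange heBtfix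
  obtain ⟨L, i1, i2, i3, V, hV, hVd⟩ := stine hΨ.cp
  have d : Dil (basicConstruction sf.J (Btilde Bset pB)) A Ψ pA V :=
    ⟨h.algN, hA, fun a ha => h.M_sub_N (hAM ha), hΨ, hV, hVd⟩
  obtain ⟨x, hx, y, hy, hne⟩ := hΨnonzero
  have hpB : pB ∈ Btilde Bset pB := ⟨pB, hB.unit_mem, 0, by simp⟩
  have hpp : pB * pB = pB := hB.unit_proj.2
  have hsa : star pB = pB := hB.unit_proj.1
  have hpM := hBM hB.unit_mem
  refine ⟨Phi (basicConstruction sf.J (Btilde Bset pB)) V (Ctx.WW M sf.J (Btilde Bset pB) eBt),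
    d.Phi_bimod h.WW_sub h.WW_mul, h.Phi_normal d hΨnormalM, ?_⟩
  refine h.Phi_nonzero d ?_ ?_ ?_ ?_ ?_ (hAM hA.unit_mem) hx hy hne
  · rw [Ctx.N_iff]
    rintro _ ⟨b, hb, c, rfl⟩
    rw [← conjJ_mul h.hJ, ← conjJ_mul h.hJ]
    congr 1
    rw [mul_add, add_mul, hB.unit_left _ hb, hB.unit_right _ hb, mul_smul_comm, smul_mul_assoc, mul_sub, sub_mul]
    simp
  · exact fun z hz => h.conj_mem hpM z hz
  · refine ContinuousLinearMap.ext fun v => ?_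
    rw [mul_apply_eq_comp, mul_apply_eq_comp, conjJ_apply h.hJ, conjJ_apply h.hJ, ← h.Jp, h.Jp v,
      ← mul_apply_eq_comp (f := eBt), h.p_comm hpB, mul_apply_eq_comp]
  · rw [conjJ_star h.hJ, hsa]
  · rw [← conjJ_mul h.hJ, hpp]

end AFP
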